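/- Let h = 2n+1 be an odd integer with n ≥ 1, let σ be an h-bar-core with exactly three addable 0-nodes and let τ = ψ_0(σ), so that P_{σ,2} and P_{τ,2} form a [2:3]-pair of residue 0. Then exactly three partitions of P_{σ,2} are exceptional (i.e. have a removable 0-node), and they can be written α ◁ β ◁ γ in the dominance order; exactly three partitions of P_{τ,2} are exceptional (i.e. have an addable 0-node), and they can be written α̂ ◁ β̂ ◁ γ̂ in the dominance order. Moreover ψ_0(α) = α̂, ψ_0(β) = γ̂ and ψ_0(γ) = β̂. -/

import Mathlib

/-- A partition: a weakly decreasing sequence of non-negative integers with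
finite sum (finitely many nonzero parts), indexed from 0 (so `parts 0` is λ₁). -/
structure BPartition where
  parts : ℕ →₀ ℕ
  antitone : ∀ r, parts (r + 1) ≤ parts r

namespace BPartition

/-- The multiset of positive parts of a partition. -/
def partsM (lam : BPartition) : Multiset ℕ :=
  lam.parts.support.val.map (fun r => lam.parts r)

/-- The Young diagram: nodes `(r, c)` with rows indexed from 0 and columns from 1. -/
def diagram (lam : BPartition) : Set (ℕ × ℕ) :=
  {x | 1 ≤ x.2 ∧ x.2 ≤ lam.parts x.1}

/-- A partition is strict if λ_r > λ_{r+1} whenever λ_r > 0. -/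
def IsStrict (lam : BPartition) : Prop :=
  ∀ r, 0 < lam.parts r → lam.parts (r + 1) < lam.parts r

/-- A partition is h-strict if each part is either strictly bigger than the next,
or positive and divisible by h, or zero. -/
def IsHStrict (h : ℕ) (lam : BPartition) : Prop :=
  ∀ r, lam.parts (r + 1) < lam.parts r ∨ (0 < lam.parts r ∧ h ∣ lam.parts r) ∨ lam.parts r = 0

/-- An h-strict partition is restricted if for every r either λ_{r+1} > λ_r − h,
or λ_{r+1} = λ_r − h and h does not divide λ_r. -/
def IsRestricted (h : ℕ) (lam : BPartition) : Prop :=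
  ∀ r, lam.parts r < lam.parts (r + 1) + h ∨
    (lam.parts (r + 1) + h = lam.parts r ∧ ¬ h ∣ lam.parts r)

/-- The residue of a node in column c (1-indexed): the smaller of the residues of
c − 1 and of −c modulo h. -/
def colRes (h c : ℕ) : ℕ := min ((c - 1) % h) ((h - c % h) % h)

/-- `x` is an addable i-node of `lam`. -/
def Addable (h i : ℕ) (lam : BPartition) (x : ℕ × ℕ) : Prop :=
  colRes h x.2 = i ∧ x ∉ diagram lam ∧
  ∃ nu : BPartition, IsHStrict h nu ∧ diagram lam ⊆ diagram nu ∧ x ∈ diagram nu ∧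
    ∀ y ∈ diagram nu, y ∉ diagram lam → colRes h y.2 = i

/-- `x` is a removable i-node of `lam`. -/
def Removable (h i : ℕ) (lam : BPartition) (x : ℕ × ℕ) : Prop :=
  x ∈ diagram lam ∧
  ∃ mu : BPartition, IsHStrict h mu ∧ diagram mu ⊆ diagram lam ∧ x ∉ diagram mu ∧
    ∀ y ∈ diagram lam, y ∉ diagram mu → colRes h y.2 = i

/-- Removal of a single h-bar from `lam` giving `mu`, recording the value `v`:
either a part `v ≥ h` is replaced by `v − h` (deleted if `v = h`), or two parts
summing to `h` are deleted, in which case `v` is the larger of the two. -/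
def barStepRec (h : ℕ) (lam mu : BPartition) (v : ℕ) : Prop :=
  IsHStrict h mu ∧
  ((v = h ∧ v ∈ partsM lam ∧ partsM mu = (partsM lam).erase v) ∨
   (h < v ∧ v ∈ partsM lam ∧ partsM mu = (v - h) ::ₘ (partsM lam).erase v) ∨
   (∃ a b : ℕ, a + b = h ∧ a ∈ partsM lam ∧ b ∈ (partsM lam).erase a ∧
      v = max a b ∧ partsM mu = ((partsM lam).erase a).erase b))

/-- Removal of a single h-bar. -/
def barStep (h : ℕ) (lam mu : BPartition) : Prop :=
  ∃ v, barStepRec h lam mu v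

/-- An h-bar-core: an h-strict partition from which no h-bar can be removed. -/
def IsBarCore (h : ℕ) (lam : BPartition) : Prop :=
  IsHStrict h lam ∧ ∀ mu, ¬ barStep h lam mu

/-- A chain of `w` h-bar removals from `lam` down to `mu`. -/
def barChain (h : ℕ) : ℕ → BPartition → BPartition → Prop
  | 0, lam, mu => lam = mu
  | w + 1, lam, mu => ∃ nu, barStep h lam nu ∧ barChain h w nu mu

/-- `lam ∈ P_{τ,w}`: `lam` is h-strict with h-bar-core `tau` and h-bar-weight `w`. -/
def InBlock (h : ℕ) (tau : BPartition) (w : ℕ) (lam : BPartition) : Prop :=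
  IsHStrict h lam ∧ IsBarCore h tau ∧ barChain h w lam tau

/-- The left-to-right order on node positions along the edge of a Young diagram:
smaller column first; within a column, larger row first. -/
def posLE (x y : ℕ × ℕ) : Prop := x.2 < y.2 ∨ (x.2 = y.2 ∧ y.1 ≤ x.1)

/-- `x` is a normal i-node: a removable i-node surviving (as a − sign) in the
reduced i-signature; equivalently, every window of the i-signature ending at `x`
contains strictly more removable than addable i-nodes. -/
def Normal (h i : ℕ) (lam : BPartition) (x : ℕ × ℕ) : Prop :=
  Removable h i lam x ∧ ∀ z : ℕ × ℕ, posLE z x →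
    Set.ncard {y | Addable h i lam y ∧ posLE z y ∧ posLE y x} <
      Set.ncard {y | Removable h i lam y ∧ posLE z y ∧ posLE y x}

/-- `x` is a conormal i-node: an addable i-node surviving (as a + sign) in the
reduced i-signature. -/
def Conormal (h i : ℕ) (lam : BPartition) (x : ℕ × ℕ) : Prop :=
  Addable h i lam x ∧ ∀ z : ℕ × ℕ, posLE x z →
    Set.ncard {y | Removable h i lam y ∧ posLE x y ∧ posLE y z} <
      Set.ncard {y | Addable h i lam y ∧ posLE x y ∧ posLE y z}

/-- The node set of ψ_i(λ): add the leftmost s − r conormal i-nodes if s ≥ r,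
remove the rightmost r − s normal i-nodes if r > s, where r = #normal and
s = #conormal i-nodes. -/
noncomputable def psiSet (h i : ℕ) (lam : BPartition) : Set (ℕ × ℕ) :=
  if Set.ncard {x | Normal h i lam x} ≤ Set.ncard {x | Conormal h i lam x} then
    diagram lam ∪ {x | Conormal h i lam x ∧
      Set.ncard {y | Conormal h i lam y ∧ posLE y x} ≤
        Set.ncard {x | Conormal h i lam x} - Set.ncard {x | Normal h i lam x}}
  else
    diagram lam \ {x | Normal h i lam x ∧
      Set.ncard {y | Normal h i lam y ∧ posLE x y} ≤
        Set.ncard {x | Normal h i lam x} - Set.ncard {x | Conormal h i lam x}}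

open Classical in
/-- The involution ψ_i. -/
noncomputable def psi (h i : ℕ) (lam : BPartition) : BPartition :=
  if hex : ∃ mu : BPartition, diagram mu = psiSet h i lam then hex.choose else lam

/-- The set of occupied positions of the abacus display of a strict partition. -/
def abacus (lam : BPartition) : Set ℤ :=
  {a | a = 0 ∨ (0 < a ∧ a.toNat ∈ partsM lam) ∨ (a < 0 ∧ (-a).toNat ∉ partsM lam)}

/-- The dominance order: λ ⊴ μ. -/
def domLE (lam mu : BPartition) : Prop :=
  ∀ r, ∑ s ∈ Finset.range r, lam.parts s ≤ ∑ s ∈ Finset.range r, mu.parts s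

/-- Strict dominance: λ ◁ μ. -/
def domLT (lam mu : BPartition) : Prop := domLE lam mu ∧ lam ≠ mu

/-- Lexicographic order: λ <lex μ. -/
def lexLT (lam mu : BPartition) : Prop :=
  ∃ r, lam.parts r < mu.parts r ∧ ∀ s < r, lam.parts s = mu.parts s

/-- Colexicographic order: λ <colex μ. -/
def colexLT (lam mu : BPartition) : Prop :=
  ∃ r, mu.parts r < lam.parts r ∧ ∀ s, r < s → lam.parts s = mu.parts s

/-- λ ↔ᵢ μ: every node of the symmetric difference of the diagrams has residue i. -/
def Link (h i : ℕ) (lam mu : BPartition) : Prop :=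
  ∀ x : ℕ × ℕ, x ∈ (diagram lam \ diagram mu) ∪ (diagram mu \ diagram lam) →
    colRes h x.2 = i

/-- `a ≤ b` are the bar positions of `lam ∈ P_{τ,2}`: the values recorded by
some two-step removal of h-bars from `lam` down to `tau`. -/
def BarPositions (h : ℕ) (tau lam : BPartition) (a b : ℕ) : Prop :=
  a ≤ b ∧ ∃ (nu : BPartition) (v₁ v₂ : ℕ), barStepRec h lam nu v₁ ∧ barStepRec h nu tau v₂ ∧
    ({a, b} : Multiset ℕ) = {v₁, v₂}

/-- The leg length of the bar of `lam ∈ P_{τ,2}` at bar position `c`. -/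
noncomputable def legLen (h : ℕ) (tau lam : BPartition) (c : ℕ) : ℕ :=
  if h ≤ c then Set.ncard {x : ℕ | c - h < x ∧ x < c ∧ x ∈ partsM lam ∧ x ∈ partsM tau}
  else (h - c) + Set.ncard {x : ℕ | h - c < x ∧ x < c ∧ x ∈ partsM lam ∧ x ∈ partsM tau}

/-- ∂λ: the absolute difference of the two leg lengths of `lam`, whose bar
positions are `a ≤ b`. -/
noncomputable def ddd (h : ℕ) (tau lam : BPartition) (a b : ℕ) : ℕ :=
  max (legLen h tau lam a) (legLen h tau lam b) - min (legLen h tau lam a) (legLen h tau lam b)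

inductive Colour | black | white | grey
deriving DecidableEq

/-- β(τ): the number of parts of τ less than h. -/
def betaCount (h : ℕ) (tau : BPartition) : ℕ :=
  Multiset.card ((partsM tau).filter (fun x => x < h))

/-- The leg length of a 2h-bar of `lam` with larger bar position `b`. -/
noncomputable def legLen2 (h : ℕ) (tau lam : BPartition) (b : ℕ) : ℕ :=
  if 2 * h ≤ b then Set.ncard {x : ℕ | b - 2 * h < x ∧ x < b ∧ x ∈ partsM lam ∧ x ∈ partsM tau}
  else (2 * h - b) + Set.ncard {x : ℕ | 2 * h - b < x ∧ x < b ∧ x ∈ partsM lam ∧ x ∈ partsM tau}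

/-- The colour of `lam ∈ P_{τ,2}` with bar positions `a ≤ b`. -/
noncomputable def colour (h : ℕ) (tau lam : BPartition) (a b : ℕ) : Colour :=
  if 2 ≤ ddd h tau lam a b then Colour.grey
  else if ddd h tau lam a b = 1 then
    if h < b then Colour.grey
    else if (min (legLen h tau lam a) (legLen h tau lam b) + betaCount h tau) % 2 = 1 then
      Colour.black else Colour.white
  else
    if b = a + h ∨ a + b = 2 * h then
      if (legLen2 h tau lam b + 2 * betaCount h tau) % 4 = 0 ∨
         (legLen2 h tau lam b + 2 * betaCount h tau) % 4 = 3 then Colour.black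
      else Colour.white
    else
      if (legLen h tau lam a + betaCount h tau) % 2 = 1 then Colour.black else Colour.white

end BPartition

set_option linter.unusedSimpArgs false
set_option linter.unusedVariables false

namespace BPartition

lemma parts_anti (lam : BPartition) {r t : ℕ} (hrt : r ≤ t) : lam.parts t ≤ lam.parts r :=
  antitone_nat_of_succ_le (f := fun r => lam.parts r) lam.antitone hrt

lemma bp_ext {lam mu : BPartition} (hp : ∀ r, lam.parts r = mu.parts r) : lam = mu := by
  cases lam; cases mu
  congr
  exact Finsupp.ext hp

lemma mem_partsM {lam : BPartition} {v : ℕ} :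
    v ∈ partsM lam ↔ 0 < v ∧ ∃ r, lam.parts r = v := by
  unfold partsM
  simp only [Multiset.mem_map, Finset.mem_val, Finsupp.mem_support_iff]
  constructor
  · rintro ⟨r, hr, rfl⟩
    exact ⟨by omega, r, rfl⟩
  · rintro ⟨hv, r, rfl⟩
    exact ⟨r, by omega, rfl⟩

def nz (x : ℕ) : Multiset ℕ := if x = 0 then 0 else {x}

lemma partsM_sum (lam : BPartition) (S : Finset ℕ) (hS : lam.parts.support ⊆ S) :
    partsM lam = ∑ r ∈ S, nz (lam.parts r) := by
  rw [← Finset.sum_subset hS]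
  · unfold partsM
    have : ∀ r ∈ lam.parts.support, nz (lam.parts r) = {lam.parts r} := by
      intro r hr
      simp only [Finsupp.mem_support_iff] at hr
      simp [nz, hr]
    rw [Finset.sum_congr rfl this, ← Multiset.sum_map_singleton (Multiset.map _ _), Multiset.map_map]
    rfl
  · intro r _ hr
    simp only [Finsupp.mem_support_iff, not_not] at hr
    simp [nz, hr]

lemma partsM_upd {lam mu : BPartition} {r v : ℕ}
    (hmu : ∀ t, mu.parts t = if t = r then v else lam.parts t) :
    partsM mu + nz (lam.parts r) = partsM lam + nz v := by
  let S := lam.parts.support ∪ mu.parts.support ∪ {r}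
  have hr : r ∈ S := by simp [S]
  rw [partsM_sum lam S (by intro x; simp +contextual [S]),
    partsM_sum mu S (by intro x; simp +contextual [S]),
    ← Finset.add_sum_erase S _ hr, ← Finset.add_sum_erase S (fun r => nz (lam.parts r)) hr]
  have : ∑ x ∈ S.erase r, nz (mu.parts x) = ∑ x ∈ S.erase r, nz (lam.parts x) := by
    apply Finset.sum_congr rfl
    intro x hx
    rw [hmu, if_neg (Finset.ne_of_mem_erase hx)]
  rw [this, hmu, if_pos rfl]
  abel

lemma hstrict_dvd {h : ℕ} {lam : BPartition} (hs : IsHStrict h lam) {r t : ℕ} (hrt : r < t)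
    (he : lam.parts r ≤ lam.parts t) (hp : 0 < lam.parts t) : h ∣ lam.parts r := by
  have h1 := parts_anti lam (show r + 1 ≤ t from hrt)
  have h2 := lam.antitone r
  rcases hs r with h3 | h3 | h3
  · omega
  · exact h3.2
  · omega

lemma count_partsM (lam : BPartition) (v : ℕ) :
    (partsM lam).count v = (lam.parts.support.filter (fun r => v = lam.parts r)).card := by
  unfold partsM
  rw [Multiset.count_map]
  rfl

lemma hstrict_count {h : ℕ} {lam : BPartition} (hs : IsHStrict h lam) {v : ℕ} (hv : ¬ h ∣ v) :
    (partsM lam).count v ≤ 1 := by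
  rw [count_partsM, Finset.card_le_one]
  intro a ha b hb
  simp only [Finset.mem_filter, Finsupp.mem_support_iff] at ha hb
  by_contra hab
  rcases Nat.lt_or_gt_of_ne hab with h1 | h1
  · exact hv (ha.2 ▸ hstrict_dvd hs h1 (by omega) (by omega))
  · exact hv (hb.2 ▸ hstrict_dvd hs h1 (by omega) (by omega))

lemma hstrict_of_count {h : ℕ} {lam : BPartition}
    (hc : ∀ v, ¬ h ∣ v → (partsM lam).count v ≤ 1) : IsHStrict h lam := by
  intro r
  by_contra hcon
  push Not at hcon
  obtain ⟨h1, h2, h3⟩ := hcon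
  have h4 := lam.antitone r
  have h5 := hc _ (h2 (by omega))
  rw [count_partsM, Finset.card_le_one] at h5
  have := h5 r (by simp [h3]) (r+1) (by simp; omega)
  omega

lemma le_parts_iff (lam : BPartition) {v r : ℕ} (hv : 0 < v) :
    v ≤ lam.parts r ↔ r < (partsM lam).countP (fun x => v ≤ x) := by
  have hcard : (partsM lam).countP (fun x => v ≤ x) =
      (lam.parts.support.filter (fun r => v ≤ lam.parts r)).card := by
    unfold partsM
    rw [Multiset.countP_map]
    rfl
  rw [hcard]
  constructor
  · intro hr
    have : Finset.range (r+1) ⊆ lam.parts.support.filter (fun r => v ≤ lam.parts r) := by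
      intro t ht
      have := parts_anti lam (show t ≤ r by simpa [Nat.lt_succ_iff] using ht)
      simp; omega
    have := Finset.card_le_card this
    simp at this; omega
  · intro hr
    by_contra hcon
    have : lam.parts.support.filter (fun r => v ≤ lam.parts r) ⊆ Finset.range r := by
      intro t ht
      simp at ht ⊢
      by_contra hh
      have := parts_anti lam (show r ≤ t by omega)
      omega
    have := Finset.card_le_card this
    simp at this; omega

lemma partsM_inj {lam mu : BPartition} (hm : partsM lam = partsM mu) : lam = mu := by
  apply bp_ext
  intro r
  have key : ∀ v, 0 < v → (v ≤ lam.parts r ↔ v ≤ mu.parts r) := by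
    intro v hv
    rw [le_parts_iff _ hv, le_parts_iff _ hv, hm]
  have h1 := key (lam.parts r)
  have h2 := key (mu.parts r)
  omega

lemma exists_partsM_list (l : List ℕ) (hl : l.Pairwise (· ≥ ·)) (h0 : ∀ x ∈ l, 0 < x) :
    ∃ lam : BPartition, partsM lam = (l : Multiset ℕ) ∧ ∀ r, lam.parts r = l.getD r 0 := by
  induction l with
  | nil => exact ⟨⟨0, by simp⟩, by simp [partsM], by simp⟩
  | cons a l ih =>
    rw [List.pairwise_cons] at hl
    obtain ⟨lam, h1, h2⟩ := ih hl.2 (fun x hx => h0 x (by simp [hx]))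
    have ha := h0 a (by simp)
    let f : ℕ → ℕ := fun r => if r = 0 then a else lam.parts (r-1)
    have hfin : ∀ r, f r ≠ 0 →
        r ∈ insert 0 (lam.parts.support.map ⟨Nat.succ, Nat.succ_injective⟩) := by
      intro r hr
      rcases r with _ | r
      · simp
      · simp only [Finset.mem_insert, Finset.mem_map]
        right
        refine ⟨r, ?_, rfl⟩
        simpa [f] using hr
    let F : ℕ →₀ ℕ := Finsupp.onFinset _ f hfin
    have hF : ∀ r, F r = f r := fun r => rfl
    have hle : lam.parts 0 ≤ a := by
      rw [h2]
      rcases l with _ | ⟨b, l⟩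
      · simp
      · simpa using hl.1 b (by simp)
    refine ⟨⟨F, ?_⟩, ?_, ?_⟩
    · intro r
      rcases r with _ | r
      · simpa [hF, f] using hle
      · simpa [hF, f] using lam.antitone r
    · rw [partsM_sum _ (insert 0 (lam.parts.support.map ⟨Nat.succ, Nat.succ_injective⟩))]
      · rw [Finset.sum_insert (by simp), Finset.sum_map]
        have : ∀ x, nz (F (Nat.succ x)) = nz (lam.parts x) := by intro x; simp [hF, f]
        simp only [Function.Embedding.coeFn_mk, this]
        rw [← partsM_sum lam _ (Finset.Subset.refl _), h1]
        simp [hF, f, nz, ha.ne']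
      · intro t ht
        exact Finsupp.support_onFinset_subset (hf := hfin) ht
    · intro r
      rcases r with _ | r
      · simp [hF, f]
      · simp [hF, f, h2]

lemma exists_partsM (M : Multiset ℕ) (h0 : ∀ x ∈ M, 0 < x) :
    ∃ lam : BPartition, partsM lam = M := by
  obtain ⟨lam, h1, -⟩ := exists_partsM_list (M.sort (· ≥ ·)) (Multiset.pairwise_sort M _)
    (by intro x hx; exact h0 x (by simpa using hx))
  exact ⟨lam, by simpa using h1⟩

lemma exists_upd (h : ℕ) (lam : BPartition) (hs : IsHStrict h lam) (r v : ℕ)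
    (h1 : ∀ t, t + 1 = r → v < lam.parts t ∨ (v = lam.parts t ∧ h ∣ v))
    (h2 : lam.parts (r+1) < v ∨ (lam.parts (r+1) = v ∧ h ∣ v)) :
    ∃ mu : BPartition, IsHStrict h mu ∧ ∀ t, mu.parts t = if t = r then v else lam.parts t := by
  have hF : ∀ t, (Finsupp.update lam.parts r v) t = if t = r then v else lam.parts t := by
    intro t
    simp [Finsupp.update_apply]
  refine ⟨⟨Finsupp.update lam.parts r v, ?_⟩, ?_, hF⟩
  · intro t
    have := lam.antitone t
    have := h1 t
    rw [hF, hF]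
    split_ifs with ha hb hb
    · omega
    · omega
    · subst hb; omega
    · omega
  · intro t
    have h3 := hs t
    have h4 := h1 t
    show Finsupp.update lam.parts r v (t+1) < Finsupp.update lam.parts r v t ∨ _ ∨ Finsupp.update lam.parts r v t = 0
    simp only [hF]
    split_ifs with ha hb hb
    · omega
    · rcases h4 ha with h5 | ⟨h5, h6⟩
      · exact Or.inl h5
      · rw [← h5]
        rcases Nat.eq_zero_or_pos v with h7 | h7
        · right; right; exact h7
        · right; left; exact ⟨h7, h6⟩
    · subst hb
      rcases h2 with h5 | ⟨h5, h6⟩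
      · exact Or.inl h5
      · rcases Nat.eq_zero_or_pos v with h7 | h7
        · right; right; exact h7
        · right; left; exact ⟨h7, h6⟩
    · exact h3

end BPartition
namespace BPartition

lemma not_dvd_between {h k x : ℕ} (h1 : k * h < x) (h2 : x < (k + 1) * h) : ¬ h ∣ x := by
  rintro ⟨m, rfl⟩
  have h3 : k < m := by
    by_contra hc
    have := Nat.mul_le_mul_left h (show m ≤ k by omega)
    rw [Nat.mul_comm k h] at h1
    omega
  have := Nat.mul_le_mul_left h (show k + 1 ≤ m by omega)
  rw [Nat.mul_comm (k+1) h] at h2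
  omega

lemma dvd_close {h a b : ℕ} (ha : h ∣ a) (hb : h ∣ b) (hab : a < b) : a + h ≤ b := by
  have := Nat.le_of_dvd (by omega) (Nat.dvd_sub hb ha)
  omega

lemma colRes_zero {h c : ℕ} (hh : 3 ≤ h) (hc : 1 ≤ c) :
    colRes h c = 0 ↔ h ∣ c ∨ h ∣ c - 1 := by
  unfold colRes
  have hlt := Nat.mod_lt c (show 0 < h by omega)
  rw [Nat.dvd_iff_mod_eq_zero, Nat.dvd_iff_mod_eq_zero]
  constructor
  · intro h1
    rcases Nat.eq_zero_or_pos (c % h) with h2 | h2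
    · exact Or.inl h2
    · right
      rw [Nat.mod_eq_of_lt (show h - c % h < h by omega)] at h1
      omega
  · rintro (h1 | h1)
    · simp [h1]
    · simp [h1]

lemma addable_iff {h : ℕ} (hh : 3 ≤ h) {lam : BPartition} (hs : IsHStrict h lam) (r c : ℕ) :
    Addable h 0 lam (r, c) ↔
      (1 ≤ c ∧ h ∣ c - 1 ∧ (lam.parts r + 1 = c ∨ lam.parts r + 2 = c) ∧
        ∀ t, t + 1 = r → c + 1 ≤ lam.parts t) ∨ (h ∣ c ∧ lam.parts r + 1 = c) := by
  constructor
  · rintro ⟨h1, h2, nu, hnu, h3, h4, h5⟩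
    simp only [diagram, Set.mem_ofPred_eq, not_and, not_le] at h1 h2 h4 h5
    obtain ⟨hc1, hc2⟩ := h4
    have h2 := h2 hc1
    have hres : ∀ t d, 1 ≤ d → d ≤ nu.parts t → lam.parts t < d → h ∣ d ∨ h ∣ d - 1 := by
      intro t d h6 h7 h8
      exact (colRes_zero hh h6).1 (h5 (t, d) ⟨h6, h7⟩ (fun _ => h8))
    rw [colRes_zero hh hc1] at h1
    rcases h1 with h1 | h1
    · right
      refine ⟨h1, ?_⟩
      by_contra hcon
      have h6 := hres r (c-1) (by omega) (by omega) (by omega)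
      have := Nat.le_of_dvd (by omega) h1
      rcases h6 with h6 | h6
      · have := dvd_close h6 h1 (by omega); omega
      · have := dvd_close h6 h1 (by omega); omega
    · left
      refine ⟨hc1, h1, ?_, ?_⟩
      · by_contra hcon
        have h6 := hres r (c-2) (by omega) (by omega) (by omega)
        rcases h6 with h6 | h6
        · have := dvd_close h6 h1 (by omega); omega
        · have := dvd_close h6 h1 (by omega); omega
      · intro t ht
        subst ht
        have hgt : c + 1 ≤ nu.parts t := by
          have := nu.antitone t
          rcases hnu t with h6 | ⟨h6, h7⟩ | h6
          · omega
          · by_contra hcon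
            have : nu.parts t = c := by omega
            rw [this] at h7
            have := dvd_close h1 h7 (by omega)
            omega
          · omega
        by_contra hcon
        have h6 := hres t (c+1) (by omega) hgt (by omega)
        rcases h6 with h6 | h6
        · have := dvd_close h1 h6 (by omega); omega
        · have := dvd_close h1 h6 (by omega); omega
  · intro hyp
    have hc1 : 1 ≤ c := by rcases hyp with hyp | hyp <;> omega
    have hlt : lam.parts r < c := by rcases hyp with ⟨_, _, h1, _⟩ | hyp <;> omega
    have hcres : h ∣ c ∨ h ∣ c - 1 := by
      rcases hyp with hyp | hyp
      · exact Or.inr hyp.2.1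
      · exact Or.inl hyp.1
    have hnext : lam.parts (r+1) < c := by have := lam.antitone r; omega
    have hprev : ∀ t, t + 1 = r → c < lam.parts t ∨ (c = lam.parts t ∧ h ∣ c) := by
      intro t ht
      rcases hyp with hyp | hyp
      · left; have := hyp.2.2.2 t ht; omega
      · subst ht
        have := lam.antitone t
        rcases Nat.lt_or_ge c (lam.parts t) with h1 | h1
        · exact Or.inl h1
        · right
          refine ⟨?_, hyp.1⟩
          by_contra hcon
          have heq : lam.parts t + 1 = c := by omega
          have hcge := Nat.le_of_dvd (by omega) hyp.1
          have h2 := hstrict_dvd hs (Nat.lt_succ_self t) (by show _ ≤ lam.parts (t+1); omega)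
            (by show _ < lam.parts (t+1); omega)
          have := dvd_close h2 hyp.1 (by omega)
          omega
    obtain ⟨nu, hnu, hpt⟩ := exists_upd h lam hs r c hprev (Or.inl hnext)
    refine ⟨(colRes_zero hh hc1).2 hcres, by simp [diagram]; omega, nu, hnu, ?_, ?_, ?_⟩
    · rintro ⟨t, d⟩
      simp only [diagram, Set.mem_ofPred_eq, hpt]
      split_ifs with ht
      · subst ht; omega
      · exact id
    · simp [diagram, hpt, hc1]
    · rintro ⟨t, d⟩
      simp only [diagram, Set.mem_ofPred_eq, hpt, not_and, not_le]
      split_ifs with ht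
      · subst ht
        rintro ⟨h6, h7⟩ h8
        have h8 := h8 h6
        rw [colRes_zero hh h6]
        rcases hyp with hyp | hyp
        · obtain ⟨-, h9, h10, -⟩ := hyp
          rcases Nat.eq_or_lt_of_le h7 with h11 | h11
          · subst h11; exact hcres
          · left
            rwa [show d = c - 1 by omega]
        · rw [show d = c by omega]; exact hcres
      · intro h6 h8
        have := h8 h6.1
        omega

lemma removable_iff {h : ℕ} (hh : 3 ≤ h) {lam : BPartition} (hs : IsHStrict h lam) (r c : ℕ) :
    Removable h 0 lam (r, c) ↔
      (1 ≤ c ∧ h ∣ c - 1 ∧ lam.parts r = c) ∨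
      (1 ≤ c ∧ h ∣ c ∧ (lam.parts r = c ∨ lam.parts r = c + 1) ∧ lam.parts (r+1) + 2 ≤ c) := by
  constructor
  · rintro ⟨h2, mu, hmu, h3, h4, h5⟩
    simp only [diagram, Set.mem_ofPred_eq, not_and, not_le] at h2 h4 h5
    obtain ⟨hc1, hc2⟩ := h2
    have h4 := h4 hc1
    have hres : ∀ t d, 1 ≤ d → d ≤ lam.parts t → mu.parts t < d → h ∣ d ∨ h ∣ d - 1 := by
      intro t d h6 h7 h8
      exact (colRes_zero hh h6).1 (h5 (t, d) ⟨h6, h7⟩ (fun _ => h8))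
    rcases hres r c hc1 hc2 h4 with h1 | h1
    · right
      have hcge := Nat.le_of_dvd (by omega) h1
      refine ⟨hc1, h1, ?_, ?_⟩
      · by_contra hcon
        rcases hres r (c+2) (by omega) (by omega) (by omega) with h6 | h6
        · have := dvd_close h1 h6 (by omega); omega
        · have := dvd_close h1 h6 (by omega); omega
      · have hmr : mu.parts r = c - 1 := by
          by_contra hcon
          rcases hres r (c-1) (by omega) (by omega) (by omega) with h6 | h6
          · have := dvd_close h6 h1 (by omega); omega
          · have := dvd_close h6 h1 (by omega); omega
        have hm1 : mu.parts (r+1) < c - 1 := by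
          rcases hmu r with h6 | ⟨h6, h7⟩ | h6
          · omega
          · rw [hmr] at h7
            have := dvd_close h7 h1 (by omega); omega
          · omega
        by_contra hcon
        rcases hres (r+1) (c-1) (by omega) (by omega) (by omega) with h6 | h6
        · have := dvd_close h6 h1 (by omega); omega
        · have := dvd_close h6 h1 (by omega); omega
    · left
      refine ⟨hc1, h1, ?_⟩
      by_contra hcon
      rcases hres r (c+1) (by omega) (by omega) (by omega) with h6 | h6
      · have := dvd_close h1 h6 (by omega); omega
      · have := dvd_close h1 h6 (by omega); omega
  · intro hyp
    have hc1 : 1 ≤ c := by rcases hyp with hyp | hyp <;> omega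
    have hle : c ≤ lam.parts r := by rcases hyp with hyp | hyp <;> omega
    have hcres : h ∣ c ∨ h ∣ c - 1 := by
      rcases hyp with hyp | hyp
      · exact Or.inr hyp.2.1
      · exact Or.inl hyp.2.1
    have hprev : ∀ t, t + 1 = r → c - 1 < lam.parts t ∨ (c - 1 = lam.parts t ∧ h ∣ c - 1) := by
      intro t ht
      subst ht
      left
      have := lam.antitone t
      omega
    have hnext : lam.parts (r+1) < c - 1 ∨ (lam.parts (r+1) = c - 1 ∧ h ∣ c - 1) := by
      rcases hyp with ⟨h1, h2, h3⟩ | ⟨h1, h2, h3, h4⟩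
      · have := lam.antitone r
        rcases Nat.lt_or_ge (lam.parts (r+1)) (c-1) with h6 | h6
        · exact Or.inl h6
        · right
          refine ⟨?_, h2⟩
          by_contra hcon
          have h7 := hstrict_dvd hs (Nat.lt_succ_self r) (by show _ ≤ lam.parts (r+1); omega)
            (by show _ < lam.parts (r+1); omega)
          rw [h3] at h7
          have := dvd_close h2 h7 (by omega)
          omega
      · left; omega
    obtain ⟨mu, hmu, hpt⟩ := exists_upd h lam hs r (c-1) hprev hnext
    refine ⟨⟨hc1, hle⟩, mu, hmu, ?_, ?_, ?_⟩
    · rintro ⟨t, d⟩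
      simp only [diagram, Set.mem_ofPred_eq, hpt]
      split_ifs with ht
      · subst ht; omega
      · exact id
    · simp [diagram, hpt]; omega
    · rintro ⟨t, d⟩
      simp only [diagram, Set.mem_ofPred_eq, hpt, not_and, not_le]
      split_ifs with ht
      · subst ht
        rintro ⟨h6, h7⟩ h8
        have h8 := h8 h6
        rw [colRes_zero hh h6]
        rcases hyp with hyp | hyp
        · rw [show d = c by omega]; exact hcres
        · obtain ⟨-, h9, h10, -⟩ := hyp
          by_cases hd : d = c
          · subst hd; exact hcres
          · right
            rwa [show d - 1 = c by omega]
      · intro h6 h8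
        have := h8 h6.1
        omega

end BPartition
namespace BPartition

lemma diagram_inj {lam mu : BPartition} (hd : diagram lam = diagram mu) : lam = mu := by
  apply bp_ext
  intro r
  have key : ∀ v, 0 < v → (v ≤ lam.parts r ↔ v ≤ mu.parts r) := by
    intro v hv
    have := Set.ext_iff.1 hd (r, v)
    simpa [diagram, Nat.one_le_iff_ne_zero, hv.ne'] using this
  have h1 := key (lam.parts r)
  have h2 := key (mu.parts r)
  omega

lemma psi_eq {h i : ℕ} {lam mu : BPartition} (hd : diagram mu = psiSet h i lam) :
    psi h i lam = mu := by
  unfold psi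
  have hex : ∃ mu : BPartition, diagram mu = psiSet h i lam := ⟨mu, hd⟩
  rw [dif_pos hex]
  exact diagram_inj (hex.choose_spec.trans hd.symm)

open Classical in
lemma ncard_fin {α : Type*} (s : Finset α) (A P : α → Prop) (hA : ∀ y, A y ↔ y ∈ s) :
    Set.ncard {y | A y ∧ P y} = ∑ y ∈ s, if P y then 1 else 0 := by
  have : {y | A y ∧ P y} = ((s.filter P : Finset α) : Set α) := by
    ext y; simp [hA]
  rw [this, Set.ncard_coe_finset, Finset.card_filter]

open Classical in
lemma ncard_1 {α : Type*} {a : α} {A : α → Prop} (P : α → Prop) (hA : ∀ y, A y ↔ y = a) :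
    Set.ncard {y | A y ∧ P y} = if P a then 1 else 0 := by
  rw [ncard_fin {a} A P (by simpa using hA), Finset.sum_singleton]

open Classical in
lemma ncard_3 {α : Type*} {a b c : α} {A : α → Prop} (P : α → Prop)
    (hA : ∀ y, A y ↔ y = a ∨ y = b ∨ y = c) (h1 : a ≠ b) (h2 : a ≠ c) (h3 : b ≠ c) :
    Set.ncard {y | A y ∧ P y} = (if P a then 1 else 0) + (if P b then 1 else 0)
      + (if P c then 1 else 0) := by
  rw [ncard_fin {a, b, c} A P (by simpa using hA),
    Finset.sum_insert (by simp [h1, h2]), Finset.sum_insert (by simp [h3]), Finset.sum_singleton]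
  omega

open Classical in
lemma ncard_4 {α : Type*} {a b c d : α} {A : α → Prop} (P : α → Prop)
    (hA : ∀ y, A y ↔ y = a ∨ y = b ∨ y = c ∨ y = d) (h1 : a ≠ b) (h2 : a ≠ c) (h3 : b ≠ c)
    (h4 : a ≠ d) (h5 : b ≠ d) (h6 : c ≠ d) :
    Set.ncard {y | A y ∧ P y} = (if P a then 1 else 0) + (if P b then 1 else 0)
      + (if P c then 1 else 0) + (if P d then 1 else 0) := by
  rw [ncard_fin {a, b, c, d} A P (by simpa using hA),
    Finset.sum_insert (by simp [h1, h2, h4]), Finset.sum_insert (by simp [h3, h5]),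
    Finset.sum_insert (by simp [h6]), Finset.sum_singleton]
  omega

lemma ind_1 {α : Type*} {a : α} {A : α → Prop} (P : α → Prop) (hA : ∀ y, A y ↔ y = a) :
    ∃ i, Set.ncard {y | A y ∧ P y} = i ∧ (P a ∧ i = 1 ∨ ¬ P a ∧ i = 0) := by
  classical
  refine ⟨_, ncard_1 P hA, ?_⟩
  by_cases hp : P a <;> simp [hp]

lemma ind_4 {α : Type*} {a b c d : α} {A : α → Prop} (P : α → Prop)
    (hA : ∀ y, A y ↔ y = a ∨ y = b ∨ y = c ∨ y = d) (h1 : a ≠ b) (h2 : a ≠ c) (h3 : b ≠ c)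
    (h4 : a ≠ d) (h5 : b ≠ d) (h6 : c ≠ d) :
    ∃ i j k l, Set.ncard {y | A y ∧ P y} = i + j + k + l ∧
      (P a ∧ i = 1 ∨ ¬ P a ∧ i = 0) ∧ (P b ∧ j = 1 ∨ ¬ P b ∧ j = 0) ∧
      (P c ∧ k = 1 ∨ ¬ P c ∧ k = 0) ∧ (P d ∧ l = 1 ∨ ¬ P d ∧ l = 0) := by
  classical
  refine ⟨_, _, _, _, ncard_4 P hA h1 h2 h3 h4 h5 h6, ?_, ?_, ?_, ?_⟩
  · by_cases hp : P a <;> simp [hp]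
  · by_cases hp : P b <;> simp [hp]
  · by_cases hp : P c <;> simp [hp]
  · by_cases hp : P d <;> simp [hp]

lemma ncard_triv {α : Type*} (A : α → Prop) :
    Set.ncard {y | A y} = Set.ncard {y | A y ∧ (fun _ => True) y} := by
  simp

/-- If the conormal nodes are exactly three, and no normal ones, then `psi` adds them. -/
lemma psi_of_three {h : ℕ} {lam mu : BPartition} {x1 x2 x3 : ℕ × ℕ}
    (h1 : x1 ≠ x2) (h2 : x1 ≠ x3) (h3 : x2 ≠ x3)
    (hN : ∀ y, ¬ Normal h 0 lam y)
    (hC : ∀ y, Conormal h 0 lam y ↔ y = x1 ∨ y = x2 ∨ y = x3)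
    (hmu : ∀ y, y ∈ diagram mu ↔ y ∈ diagram lam ∨ y = x1 ∨ y = x2 ∨ y = x3) :
    psi h 0 lam = mu := by
  apply psi_eq
  have e1 : Set.ncard {x | Normal h 0 lam x} = 0 := by simp [hN]
  have e2 : Set.ncard {x | Conormal h 0 lam x} = 3 := by
    rw [ncard_triv, ncard_3 _ hC h1 h2 h3]; simp
  unfold psiSet
  rw [e1, e2, if_pos (by omega)]
  ext y
  rw [hmu, Set.mem_union, Set.mem_ofPred_eq, hC]
  have e3 : Set.ncard {z | Conormal h 0 lam z ∧ posLE z y} ≤ 3 - 0 := by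
    rw [ncard_3 _ hC h1 h2 h3]; split_ifs <;> omega
  simp [e3]

lemma psi_ppp {h : ℕ} {lam mu : BPartition} {r1 r2 r3 c1 c2 c3 : ℕ}
    (l1 : c1 < c2) (l2 : c2 < c3)
    (hR : ∀ y, ¬ Removable h 0 lam y)
    (hA : ∀ y, Addable h 0 lam y ↔ y = (r1, c1) ∨ y = (r2, c2) ∨ y = (r3, c3))
    (hmu : ∀ y, y ∈ diagram mu ↔ y ∈ diagram lam ∨ y = (r1, c1) ∨ y = (r2, c2) ∨ y = (r3, c3)) :
    psi h 0 lam = mu := by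
  have n1 : (r1, c1) ≠ (r2, c2) := by simp; omega
  have n2 : (r1, c1) ≠ (r3, c3) := by simp; omega
  have n3 : (r2, c2) ≠ (r3, c3) := by simp; omega
  refine psi_of_three n1 n2 n3 (fun y hy => hR y hy.1) ?_ hmu
  intro y
  rw [← hA]
  refine ⟨fun hy => hy.1, fun hy => ⟨hy, fun z hz => ?_⟩⟩
  have e1 : {w | Removable h 0 lam w ∧ posLE y w ∧ posLE w z} = ∅ := by
    ext w; simp [hR]
  have hyz : posLE y y := Or.inr ⟨rfl, le_rfl⟩
  rw [e1, ncard_3 _ hA n1 n2 n3, Set.ncard_empty]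
  rcases (hA y).1 hy with rfl | rfl | rfl
  · rw [if_pos ⟨hyz, hz⟩]; omega
  · rw [if_pos (⟨hyz, hz⟩ : posLE (r2,c2) (r2,c2) ∧ _)]; omega
  · rw [if_pos (⟨hyz, hz⟩ : posLE (r3,c3) (r3,c3) ∧ _)]; omega

/-- signature `+-+++`. -/
lemma psi_beta {h : ℕ} {lam mu : BPartition} {r1 r2 r3 r4 c1 c2 c3 c4 rb b : ℕ}
    (l1 : c1 < b) (l2 : b < c2) (l3 : c2 < c3) (l4 : c3 < c4)
    (hR : ∀ y, Removable h 0 lam y ↔ y = (rb, b))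
    (hA : ∀ y, Addable h 0 lam y ↔ y = (r1, c1) ∨ y = (r2, c2) ∨ y = (r3, c3) ∨ y = (r4, c4))
    (hmu : ∀ y, y ∈ diagram mu ↔ y ∈ diagram lam ∨ y = (r2, c2) ∨ y = (r3, c3) ∨ y = (r4, c4)) :
    psi h 0 lam = mu := by
  have n1 : (r1, c1) ≠ (r2, c2) := by simp; omega
  have n2 : (r1, c1) ≠ (r3, c3) := by simp; omega
  have n3 : (r2, c2) ≠ (r3, c3) := by simp; omega
  have n4 : (r1, c1) ≠ (r4, c4) := by simp; omega
  have n5 : (r2, c2) ≠ (r4, c4) := by simp; omega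
  have n6 : (r3, c3) ≠ (r4, c4) := by simp; omega
  refine psi_of_three n3 n5 n6 ?_ ?_ hmu
  · rintro y ⟨hy, hz⟩
    rw [hR] at hy
    subst hy
    have := hz (r1, c1) (Or.inl l1)
    obtain ⟨i0, e0, s0⟩ := ind_1 (fun y => posLE (r1, c1) y ∧ posLE y (rb, b)) hR
    obtain ⟨i1, i2, i3, i4, e1, s1, s2, s3, s4⟩ := ind_4 (fun y => posLE (r1, c1) y ∧ posLE y (rb, b)) hA n1 n2 n3 n4 n5 n6
    rw [e0, e1] at this
    simp only [posLE, lt_self_iff_false, le_refl, true_and, false_or, and_true, or_true, not_true_eq_false, false_and, or_false] at s0 s1 s2 s3 s4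
    omega
  · rintro y
    constructor
    · rintro ⟨hy, hz⟩
      rw [hA] at hy
      rcases hy with rfl | hy
      · have := hz (rb, b) (Or.inl l1)
        obtain ⟨i0, e0, s0⟩ := ind_1 (fun y => posLE (r1, c1) y ∧ posLE y (rb, b)) hR
        obtain ⟨i1, i2, i3, i4, e1, s1, s2, s3, s4⟩ := ind_4 (fun y => posLE (r1, c1) y ∧ posLE y (rb, b)) hA n1 n2 n3 n4 n5 n6
        rw [e0, e1] at this
        simp only [posLE, lt_self_iff_false, le_refl, true_and, false_or, and_true, or_true, not_true_eq_false, false_and, or_false] at s0 s1 s2 s3 s4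
        omega
      · exact hy
    · intro hy
      refine ⟨(hA y).2 (Or.inr hy), ?_⟩
      rintro ⟨zr, zc⟩ hz
      obtain ⟨i0, e0, s0⟩ := ind_1 (fun w => posLE y w ∧ posLE w (zr, zc)) hR
      obtain ⟨i1, i2, i3, i4, e1, s1, s2, s3, s4⟩ := ind_4 (fun w => posLE y w ∧ posLE w (zr, zc)) hA n1 n2 n3 n4 n5 n6
      rw [e0, e1]
      rcases hy with rfl | rfl | rfl <;> simp only [posLE, lt_self_iff_false, le_refl, true_and, false_or, and_true, or_true, not_true_eq_false, false_and, or_false] at hz s0 s1 s2 s3 s4 <;> omega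

/-- signature `+++-+`. -/
lemma psi_gamma {h : ℕ} {lam mu : BPartition} {r1 r2 r3 r4 c1 c2 c3 c4 rb b : ℕ}
    (l1 : c1 < c2) (l2 : c2 < c3) (l3 : c3 < b) (l4 : b < c4)
    (hR : ∀ y, Removable h 0 lam y ↔ y = (rb, b))
    (hA : ∀ y, Addable h 0 lam y ↔ y = (r1, c1) ∨ y = (r2, c2) ∨ y = (r3, c3) ∨ y = (r4, c4))
    (hmu : ∀ y, y ∈ diagram mu ↔ y ∈ diagram lam ∨ y = (r1, c1) ∨ y = (r2, c2) ∨ y = (r4, c4)) :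
    psi h 0 lam = mu := by
  have n1 : (r1, c1) ≠ (r2, c2) := by simp; omega
  have n2 : (r1, c1) ≠ (r3, c3) := by simp; omega
  have n3 : (r2, c2) ≠ (r3, c3) := by simp; omega
  have n4 : (r1, c1) ≠ (r4, c4) := by simp; omega
  have n5 : (r2, c2) ≠ (r4, c4) := by simp; omega
  have n6 : (r3, c3) ≠ (r4, c4) := by simp; omega
  refine psi_of_three n1 n4 n5 ?_ ?_ hmu
  · rintro y ⟨hy, hz⟩
    rw [hR] at hy
    subst hy
    have := hz (r3, c3) (Or.inl l3)
    obtain ⟨i0, e0, s0⟩ := ind_1 (fun y => posLE (r3, c3) y ∧ posLE y (rb, b)) hR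
    obtain ⟨i1, i2, i3, i4, e1, s1, s2, s3, s4⟩ := ind_4 (fun y => posLE (r3, c3) y ∧ posLE y (rb, b)) hA n1 n2 n3 n4 n5 n6
    rw [e0, e1] at this
    simp only [posLE, lt_self_iff_false, le_refl, true_and, false_or, and_true, or_true, not_true_eq_false, false_and, or_false] at s0 s1 s2 s3 s4
    omega
  · rintro y
    constructor
    · rintro ⟨hy, hz⟩
      rw [hA] at hy
      rcases hy with hy | hy | rfl | hy
      · exact Or.inl hy
      · exact Or.inr (Or.inl hy)
      · have := hz (rb, b) (Or.inl l3)
        obtain ⟨i0, e0, s0⟩ := ind_1 (fun y => posLE (r3, c3) y ∧ posLE y (rb, b)) hR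
        obtain ⟨i1, i2, i3, i4, e1, s1, s2, s3, s4⟩ := ind_4 (fun y => posLE (r3, c3) y ∧ posLE y (rb, b)) hA n1 n2 n3 n4 n5 n6
        rw [e0, e1] at this
        simp only [posLE, lt_self_iff_false, le_refl, true_and, false_or, and_true, or_true, not_true_eq_false, false_and, or_false] at s0 s1 s2 s3 s4
        omega
      · exact Or.inr (Or.inr hy)
    · intro hy
      refine ⟨(hA y).2 (by tauto), ?_⟩
      rintro ⟨zr, zc⟩ hz
      obtain ⟨i0, e0, s0⟩ := ind_1 (fun w => posLE y w ∧ posLE w (zr, zc)) hR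
      obtain ⟨i1, i2, i3, i4, e1, s1, s2, s3, s4⟩ := ind_4 (fun w => posLE y w ∧ posLE w (zr, zc)) hA n1 n2 n3 n4 n5 n6
      rw [e0, e1]
      rcases hy with rfl | rfl | rfl <;> simp only [posLE, lt_self_iff_false, le_refl, true_and, false_or, and_true, or_true, not_true_eq_false, false_and, or_false] at hz s0 s1 s2 s3 s4 <;> omega

/-- signature `-++++`. -/
lemma psi_alpha {h : ℕ} {lam mu : BPartition} {r1 r2 r3 r4 c1 c2 c3 c4 rb b : ℕ}
    (l1 : b < c1) (l2 : c1 < c2) (l3 : c2 < c3) (l4 : c3 < c4)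
    (hR : ∀ y, Removable h 0 lam y ↔ y = (rb, b))
    (hA : ∀ y, Addable h 0 lam y ↔ y = (r1, c1) ∨ y = (r2, c2) ∨ y = (r3, c3) ∨ y = (r4, c4))
    (hmu : ∀ y, y ∈ diagram mu ↔ y ∈ diagram lam ∨ y = (r1, c1) ∨ y = (r2, c2) ∨ y = (r3, c3)) :
    psi h 0 lam = mu := by
  have n1 : (r1, c1) ≠ (r2, c2) := by simp; omega
  have n2 : (r1, c1) ≠ (r3, c3) := by simp; omega
  have n3 : (r2, c2) ≠ (r3, c3) := by simp; omega
  have n4 : (r1, c1) ≠ (r4, c4) := by simp; omega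
  have n5 : (r2, c2) ≠ (r4, c4) := by simp; omega
  have n6 : (r3, c3) ≠ (r4, c4) := by simp; omega
  have hN : ∀ y, Normal h 0 lam y ↔ y = (rb, b) := by
    intro y
    rw [← hR]
    refine ⟨fun hy => hy.1, fun hy => ⟨hy, ?_⟩⟩
    rw [hR] at hy
    subst hy
    rintro ⟨zr, zc⟩ hz
    obtain ⟨i0, e0, s0⟩ := ind_1 (fun y => posLE (zr, zc) y ∧ posLE y (rb, b)) hR
    obtain ⟨i1, i2, i3, i4, e1, s1, s2, s3, s4⟩ := ind_4 (fun y => posLE (zr, zc) y ∧ posLE y (rb, b)) hA n1 n2 n3 n4 n5 n6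
    rw [e0, e1]
    simp only [posLE, lt_self_iff_false, le_refl, true_and, false_or, and_true, or_true, not_true_eq_false, false_and, or_false] at hz s0 s1 s2 s3 s4
    omega
  have hC : ∀ y, Conormal h 0 lam y ↔
      y = (r1, c1) ∨ y = (r2, c2) ∨ y = (r3, c3) ∨ y = (r4, c4) := by
    intro y
    rw [← hA]
    refine ⟨fun hy => hy.1, fun hy => ⟨hy, ?_⟩⟩
    rw [hA] at hy
    rintro ⟨zr, zc⟩ hz
    obtain ⟨i0, e0, s0⟩ := ind_1 (fun w => posLE y w ∧ posLE w (zr, zc)) hR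
    obtain ⟨i1, i2, i3, i4, e1, s1, s2, s3, s4⟩ := ind_4 (fun w => posLE y w ∧ posLE w (zr, zc)) hA n1 n2 n3 n4 n5 n6
    rw [e0, e1]
    rcases hy with rfl | rfl | rfl | rfl <;> simp only [posLE, lt_self_iff_false, le_refl, true_and, false_or, and_true, or_true, not_true_eq_false, false_and, or_false] at hz s0 s1 s2 s3 s4 <;> omega
  apply psi_eq
  have e1 : Set.ncard {x | Normal h 0 lam x} = 1 := by
    rw [ncard_triv, ncard_1 _ hN]; simp
  have e2 : Set.ncard {x | Conormal h 0 lam x} = 4 := by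
    rw [ncard_triv, ncard_4 _ hC n1 n2 n3 n4 n5 n6]; simp
  unfold psiSet
  rw [e1, e2, if_pos (by omega)]
  ext y
  rw [hmu, Set.mem_union, Set.mem_ofPred_eq]
  refine or_congr Iff.rfl ?_
  constructor
  · intro hy
    refine ⟨(hC y).2 (by tauto), ?_⟩
    obtain ⟨i1, i2, i3, i4, e1, s1, s2, s3, s4⟩ := ind_4 (fun w => posLE w y) hC n1 n2 n3 n4 n5 n6
    rw [e1]
    rcases hy with rfl | rfl | rfl <;> simp only [posLE, lt_self_iff_false, le_refl, true_and, false_or, and_true, or_true, not_true_eq_false, false_and, or_false] at s1 s2 s3 s4 <;> omega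
  · rintro ⟨hy, hc⟩
    rw [hC] at hy
    rcases hy with hy | hy | hy | rfl
    · exact Or.inl hy
    · exact Or.inr (Or.inl hy)
    · exact Or.inr (Or.inr hy)
    · obtain ⟨i1, i2, i3, i4, e1, s1, s2, s3, s4⟩ := ind_4 (fun w => posLE w (r4, c4)) hC n1 n2 n3 n4 n5 n6
      rw [e1] at hc
      simp only [posLE, lt_self_iff_false, le_refl, true_and, false_or, and_true, or_true, not_true_eq_false, false_and, or_false] at s1 s2 s3 s4
      omega

lemma dom_step {lam mu : BPartition} {a b : ℕ} (hab : a < b)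
    (ha : mu.parts a = lam.parts a + 1) (hb : mu.parts b + 1 = lam.parts b)
    (ho : ∀ t, t ≠ a → t ≠ b → mu.parts t = lam.parts t) : domLT lam mu := by
  constructor
  · intro r
    have key : ∀ r, ∑ s ∈ Finset.range r, mu.parts s + (if b < r then 1 else 0) =
        ∑ s ∈ Finset.range r, lam.parts s + (if a < r then 1 else 0) := by
      intro r
      induction r with
      | zero => simp
      | succ r ih =>
        rw [Finset.sum_range_succ, Finset.sum_range_succ]
        by_cases h1 : r = a
        · subst h1
          split_ifs at ih ⊢ <;> omega
        · by_cases h2 : r = b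
          · subst h2
            split_ifs at ih ⊢ <;> omega
          · have := ho r h1 h2
            split_ifs at ih ⊢ <;> omega
    have := key r
    split_ifs at this <;> omega
  · rintro rfl
    omega

end BPartition
namespace BPartition

def Zr (h v : ℕ) : Prop := h ∣ v ∨ h ∣ v + 1 ∨ h ∣ v - 1

lemma dvd_near {h k d : ℕ} (hk : h ∣ k) (hd : h ∣ d) (h1 : k < d + h) (h2 : d < k + h) : d = k := by
  rcases Nat.lt_trichotomy d k with h3 | h3 | h3
  · have := dvd_close hd hk h3; omega
  · exact h3
  · have := dvd_close hk hd h3; omega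

lemma has_rem {h : ℕ} (hh : 3 ≤ h) {lam : BPartition} (hs : IsHStrict h lam) {x : ℕ × ℕ}
    (hx : Removable h 0 lam x) :
    ∃ v ∈ partsM lam, h ∣ v - 1 ∨ (h ∣ v ∧ v - 1 ∉ partsM lam) := by
  obtain ⟨r, c⟩ := x
  rw [removable_iff hh hs] at hx
  rcases hx with ⟨h1, h2, h3⟩ | ⟨h1, h2, h3, h4⟩
  · exact ⟨c, mem_partsM.2 ⟨by omega, r, h3⟩, Or.inl h2⟩
  · rcases h3 with h3 | h3
    · refine ⟨c, mem_partsM.2 ⟨by omega, r, h3⟩, Or.inr ⟨h2, ?_⟩⟩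
      intro hm
      obtain ⟨h5, t, ht⟩ := mem_partsM.1 hm
      rcases Nat.lt_or_ge r t with h6 | h6
      · have := parts_anti lam (show r + 1 ≤ t from h6); omega
      · have := parts_anti lam h6; omega
    · exact ⟨c + 1, mem_partsM.2 ⟨by omega, r, h3⟩, Or.inl h2⟩

lemma has_add {h : ℕ} (hh : 3 ≤ h) {lam : BPartition} (hs : IsHStrict h lam) {x : ℕ × ℕ}
    (hx : Addable h 0 lam x) :
    1 ∉ partsM lam ∨ ∃ v ∈ partsM lam, h ∣ v + 1 ∨ (h ∣ v ∧ v + 1 ∉ partsM lam) := by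
  obtain ⟨r, c⟩ := x
  rw [addable_iff hh hs] at hx
  rcases hx with ⟨h1, h2, h3, h4⟩ | ⟨h2, h3⟩
  · rcases h3 with h3 | h3
    · have hn : c ∉ partsM lam := by
        intro hm
        obtain ⟨h5, t, ht⟩ := mem_partsM.1 hm
        rcases Nat.lt_or_ge t r with h6 | h6
        · have := h4 (r-1) (by omega)
          have := parts_anti lam (show t ≤ r - 1 by omega)
          omega
        · have := parts_anti lam h6; omega
      by_cases h0 : lam.parts r = 0
      · left; rwa [show c = 1 by omega] at hn
      · right
        refine ⟨lam.parts r, mem_partsM.2 ⟨by omega, r, rfl⟩, Or.inr ⟨?_, ?_⟩⟩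
        · rwa [show lam.parts r = c - 1 by omega]
        · rwa [h3]
    · right
      have h5 : h ∣ lam.parts r + 1 := by rwa [show lam.parts r + 1 = c - 1 by omega]
      have := Nat.le_of_dvd (by omega) h5
      exact ⟨lam.parts r, mem_partsM.2 ⟨by omega, r, rfl⟩, Or.inl h5⟩
  · right
    rw [← h3] at h2
    have := Nat.le_of_dvd (by omega) h2
    exact ⟨lam.parts r, mem_partsM.2 ⟨by omega, r, rfl⟩, Or.inl h2⟩

lemma exists_hstrict (h : ℕ) (M : Multiset ℕ) (h0 : ∀ x ∈ M, 0 < x)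
    (hc : ∀ v, ¬ h ∣ v → M.count v ≤ 1) :
    ∃ lam : BPartition, IsHStrict h lam ∧ partsM lam = M := by
  obtain ⟨lam, hl⟩ := exists_partsM M h0
  exact ⟨lam, hstrict_of_count (by rw [hl]; exact hc), hl⟩

lemma partsM_pos {lam : BPartition} {v : ℕ} (hv : v ∈ partsM lam) : 0 < v := (mem_partsM.1 hv).1

structure CoreP (h : ℕ) (M : Multiset ℕ) : Prop where
  nd : ∀ v ∈ M, ¬ h ∣ v
  down : ∀ v ∈ M, h < v → v - h ∈ M
  pair : ∀ a ∈ M, ∀ b ∈ M, a + b ≠ h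

lemma core_props {n h : ℕ} (hh : h = 2 * n + 1) {lam : BPartition} (hc : IsBarCore h lam) :
    CoreP h (partsM lam) := by
  obtain ⟨hs, hno⟩ := hc
  have hcnt : ∀ v, ¬ h ∣ v → (partsM lam).count v ≤ 1 := fun v hv => hstrict_count hs hv
  have hA : ∀ v ∈ partsM lam, h < v → (¬ h ∣ v - h → v - h ∉ partsM lam) → False := by
    intro v hv hlt hn
    obtain ⟨mu, hm, hmu⟩ := exists_hstrict h ((v - h) ::ₘ (partsM lam).erase v)
      (by
        intro x hx
        rcases Multiset.mem_cons.1 hx with rfl | hx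
        · omega
        · exact partsM_pos (Multiset.mem_of_mem_erase hx))
      (by
        intro w hw
        rw [Multiset.count_cons]
        split_ifs with hwv
        · subst hwv
          have := Multiset.count_eq_zero.2 (hn hw)
          have := Multiset.count_le_of_le (v-h) (Multiset.erase_le v (partsM lam))
          omega
        · have := Multiset.count_le_of_le w (Multiset.erase_le v (partsM lam))
          have := hcnt w hw
          omega)
    exact hno mu ⟨v, hm, Or.inr (Or.inl ⟨hlt, hv, hmu⟩)⟩
  have hnh : h ∉ partsM lam := by
    intro hv
    obtain ⟨mu, hm, hmu⟩ := exists_hstrict h ((partsM lam).erase h)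
      (fun x hx => partsM_pos (Multiset.mem_of_mem_erase hx))
      (fun w hw => (Multiset.count_le_of_le w (Multiset.erase_le h (partsM lam))).trans (hcnt w hw))
    exact hno mu ⟨h, hm, Or.inl ⟨rfl, hv, hmu⟩⟩
  refine ⟨?_, ?_, ?_⟩
  · intro v hv hd
    have hpos := partsM_pos hv
    have hle := Nat.le_of_dvd hpos hd
    rcases Nat.eq_or_lt_of_le hle with h1 | h1
    · exact hnh (h1 ▸ hv)
    · exact hA v hv h1 (fun hcon => absurd (Nat.dvd_sub hd dvd_rfl) hcon)
  · intro v hv hlt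
    by_contra hcon
    exact hA v hv hlt (fun _ => hcon)
  · intro a ha b hb hab
    have hne : b ≠ a := by omega
    obtain ⟨mu, hm, hmu⟩ := exists_hstrict h (((partsM lam).erase a).erase b)
      (fun x hx => partsM_pos (Multiset.mem_of_mem_erase (Multiset.mem_of_mem_erase hx)))
      (fun w hw => ((Multiset.count_le_of_le w (Multiset.erase_le b _)).trans
        (Multiset.count_le_of_le w (Multiset.erase_le a (partsM lam)))).trans (hcnt w hw))
    exact hno mu ⟨_, hm, Or.inr (Or.inr ⟨a, b, hab, ha, (Multiset.mem_erase_of_ne hne).2 hb, rfl, hmu⟩)⟩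

lemma core_of_props {h : ℕ} (hh : 3 ≤ h) {lam : BPartition} (hs : IsHStrict h lam)
    (hc : CoreP h (partsM lam)) : IsBarCore h lam := by
  refine ⟨hs, ?_⟩
  rintro mu ⟨v, hm, (⟨h1, h2, h3⟩ | ⟨h1, h2, h3⟩ | ⟨a, b, h1, h2, h3, h4, h5⟩)⟩
  · exact hc.nd v h2 (h1 ▸ dvd_rfl)
  · have h4 := hc.down v h2 h1
    have h5 := hstrict_count hm (hc.nd _ h4)
    rw [h3, Multiset.count_cons_self] at h5
    have : v - h ∈ (partsM lam).erase v := (Multiset.mem_erase_of_ne (by omega)).2 h4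
    have := Multiset.count_pos.2 this
    omega
  · exact hc.pair a h2 b (Multiset.mem_of_mem_erase h3) h1

lemma core_desc {h : ℕ} {M : Multiset ℕ} (hc : CoreP h M) {v : ℕ} (hv : 1 ≤ v) (k : ℕ)
    (hm : v + k * h ∈ M) : v ∈ M := by
  induction k with
  | zero => simpa using hm
  | succ k ih =>
    apply ih
    have := hc.down _ hm (by rw [Nat.add_mul]; omega)
    rwa [show v + (k+1) * h - h = v + k * h by rw [Nat.add_mul]; omega] at this

lemma core_one {h : ℕ} {M : Multiset ℕ} (hc : CoreP h M) {v : ℕ} (hv : v ∈ M) (h0 : 0 < v)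
    (hd : h ∣ v - 1) : 1 ∈ M := by
  obtain ⟨k, hk⟩ := hd
  apply core_desc hc le_rfl k
  rwa [show 1 + k * h = v by rw [Nat.mul_comm]; omega]

lemma core_neg {h : ℕ} (hh : 3 ≤ h) {M : Multiset ℕ} (hc : CoreP h M) {v : ℕ} (hv : v ∈ M)
    (hd : h ∣ v + 1) : h - 1 ∈ M ∧ (v ≠ h - 1 → 2 * h - 1 ∈ M) := by
  obtain ⟨k, hk⟩ := hd
  rcases k with _ | k
  · simp at hk
  constructor
  · apply core_desc hc (by omega) k
    rwa [show h - 1 + k * h = v by rw [Nat.mul_add, Nat.mul_comm] at hk; omega]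
  · intro hne
    rcases k with _ | k
    · simp at hk; omega
    · apply core_desc hc (by omega) k
      rwa [show 2 * h - 1 + k * h = v by
        rw [show h * (k + 1 + 1) = k * h + 2 * h by ring] at hk; omega]

lemma addable_pair {h : ℕ} (hh : 3 ≤ h) {lam : BPartition} (hs : IsHStrict h lam) {r c : ℕ}
    (h1 : lam.parts r + 1 = c) (h2 : h ∣ c) (h3 : c ∉ partsM lam) (h4 : c + 1 ∉ partsM lam) :
    Addable h 0 lam (r, c) ∧ Addable h 0 lam (r, c + 1) := by
  have hle := Nat.le_of_dvd (by omega) h2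
  refine ⟨(addable_iff hh hs _ _).2 (Or.inr ⟨h2, h1⟩),
    (addable_iff hh hs _ _).2 (Or.inl ⟨by omega, by simpa using h2, by omega, ?_⟩)⟩
  rintro t rfl
  have := lam.antitone t
  by_contra hcon
  have h5 : lam.parts t = c - 1 ∨ lam.parts t = c ∨ lam.parts t = c + 1 := by omega
  rcases h5 with h5 | h5 | h5
  · have h6 := hstrict_dvd hs (Nat.lt_succ_self t) (by show _ ≤ lam.parts (t+1); omega)
      (by show _ < lam.parts (t+1); omega)
    have := dvd_near h2 h6 (by omega) (by omega)
    omega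
  · exact h3 (mem_partsM.2 ⟨by omega, t, h5⟩)
  · exact h4 (mem_partsM.2 ⟨by omega, t, h5⟩)

lemma core_three {n h : ℕ} (hn : 1 ≤ n) (hh : h = 2 * n + 1) {lam : BPartition}
    (hc : IsBarCore h lam) (hcnt : Set.ncard {x : ℕ × ℕ | Addable h 0 lam x} = 3) :
    h - 1 ∈ partsM lam ∧ ∀ v ∈ partsM lam, Zr h v → v = h - 1 := by
  have hP := core_props hh hc
  have hs := hc.1
  have h3 : 3 ≤ h := by omega
  have h1 : 1 ∉ partsM lam := by
    intro h1
    have : {x : ℕ × ℕ | Addable h 0 lam x} = ∅ := by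
      ext x
      simp only [Set.mem_ofPred_eq, Set.mem_empty_iff_false, iff_false]
      intro hx
      rcases has_add h3 hs hx with h4 | ⟨v, hv, h4 | h4⟩
      · exact h4 h1
      · exact hP.pair _ h1 _ (core_neg h3 hP hv h4).1 (by omega)
      · exact hP.nd v hv h4.1
    rw [this] at hcnt
    simp at hcnt
  have hno1 : ∀ v ∈ partsM lam, ¬ h ∣ v - 1 := fun v hv hd => h1 (core_one hP hv (partsM_pos hv) hd)
  have hneg : h - 1 ∈ partsM lam := by
    by_contra hcon
    have key : ∀ r c, Addable h 0 lam (r, c) → c = 1 ∧ lam.parts r = 0 ∧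
        ∀ t, t + 1 = r → 2 ≤ lam.parts t := by
      intro r c hx
      have hr : lam.parts r ≠ 0 → ¬ h ∣ lam.parts r ∧ ¬ h ∣ lam.parts r + 1 := by
        intro h0
        have hm : lam.parts r ∈ partsM lam := mem_partsM.2 ⟨by omega, r, rfl⟩
        exact ⟨hP.nd _ hm, fun hd => hcon (core_neg h3 hP hm hd).1⟩
      have h01 : ¬ h ∣ 1 := fun hd => by have := Nat.le_of_dvd (by omega) hd; omega
      rw [addable_iff h3 hs] at hx
      rcases hx with ⟨g1, g2, g3, g4⟩ | ⟨g1, g2⟩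
      · by_cases h0 : lam.parts r = 0
        · rcases g3 with g3 | g3
          · refine ⟨by omega, h0, fun t ht => ?_⟩
            have := g4 t ht; omega
          · rw [show c - 1 = 1 by omega] at g2
            exact absurd g2 h01
        · rcases g3 with g3 | g3
          · rw [show c - 1 = lam.parts r by omega] at g2
            exact absurd g2 (hr h0).1
          · rw [show c - 1 = lam.parts r + 1 by omega] at g2
            exact absurd g2 (hr h0).2
      · by_cases h0 : lam.parts r = 0
        · rw [show c = 1 by omega] at g1
          exact absurd g1 h01
        · rw [← g2] at g1
          exact absurd g1 (hr h0).2
    have hsub : {x : ℕ × ℕ | Addable h 0 lam x}.Subsingleton := by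
      rintro ⟨r, c⟩ hx ⟨r', c'⟩ hx'
      obtain ⟨a1, a2, a3⟩ := key r c hx
      obtain ⟨b1, b2, b3⟩ := key r' c' hx'
      have : r = r' := by
        rcases Nat.lt_trichotomy r r' with h5 | h5 | h5
        · have := b3 (r'-1) (by omega)
          have := parts_anti lam (show r ≤ r' - 1 by omega)
          omega
        · exact h5
        · have := a3 (r-1) (by omega)
          have := parts_anti lam (show r' ≤ r - 1 by omega)
          omega
      rw [this, a1, b1]
    rcases hsub.eq_empty_or_singleton with h5 | ⟨x, h5⟩ <;> rw [h5] at hcnt <;> simp at hcnt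
  refine ⟨hneg, ?_⟩
  rintro v hv (h4 | h4 | h4)
  · exact absurd h4 (hP.nd v hv)
  · by_contra hne
    have h5 := (core_neg h3 hP hv h4).2 hne
    obtain ⟨-, q, hq⟩ := mem_partsM.1 hneg
    obtain ⟨-, p, hp⟩ := mem_partsM.1 h5
    have e1 := addable_pair h3 hs (r := q) (c := h) (by omega) dvd_rfl
      (fun hm => hP.nd _ hm dvd_rfl) (fun hm => hno1 _ hm (by simp))
    have e2 := addable_pair h3 hs (r := p) (c := 2 * h) (by omega) (Dvd.intro_left 2 rfl)
      (fun hm => hP.nd _ hm (Dvd.intro_left 2 rfl)) (fun hm => hno1 _ hm (by simp))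
    have hfin : {x : ℕ × ℕ | Addable h 0 lam x}.Finite := Set.finite_of_ncard_ne_zero (by omega)
    have hsub : (({(q, h), (q, h+1), (p, 2*h), (p, 2*h+1)} : Finset (ℕ × ℕ)) : Set (ℕ × ℕ)) ⊆
        {x : ℕ × ℕ | Addable h 0 lam x} := by
      intro x hx
      simp only [Finset.coe_insert, Finset.coe_singleton, Set.mem_insert_iff,
        Set.mem_singleton_iff] at hx
      rcases hx with rfl | rfl | rfl | rfl
      · exact e1.1
      · exact e1.2
      · exact e2.1
      · exact e2.2
    have hle := Set.ncard_le_ncard hsub hfin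
    rw [Set.ncard_coe_finset, hcnt] at hle
    rw [Finset.card_insert_of_notMem (by simp; omega), Finset.card_insert_of_notMem (by simp; omega),
      Finset.card_insert_of_notMem (by simp), Finset.card_singleton] at hle
    omega
  · exact absurd h4 (hno1 v hv)

end BPartition
namespace BPartition

structure Slot (h K r : ℕ) (lam : BPartition) : Prop where
  dvd : h ∣ K
  big : K = 0 ∨ h ≤ K
  lo : K ≤ lam.parts r + 1
  hi : lam.parts r ≤ K + 1
  above : ∀ t, t + 1 = r → K + 2 ≤ lam.parts t
  below : lam.parts (r+1) + 2 ≤ K ∨ (K = 0 ∧ lam.parts (r+1) = 0)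

lemma slot_add {h K r : ℕ} (hh : 3 ≤ h) {lam : BPartition} (hs : IsHStrict h lam)
    (S : Slot h K r lam) (c : ℕ) : Addable h 0 lam (r, c) ↔
      1 ≤ c ∧ ((c = K ∧ lam.parts r + 1 = K) ∨ (c = K + 1 ∧ lam.parts r ≤ K)) := by
  rw [addable_iff hh hs]
  obtain ⟨h1, h2, h3, h4, h5, h6⟩ := S
  constructor
  · rintro (⟨a1, a2, a3, a4⟩ | ⟨a1, a2⟩)
    · have := dvd_near a2 h1 (by omega) (by omega)
      omega
    · have := dvd_near a1 h1 (by omega) (by omega)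
      omega
  · rintro ⟨a0, ⟨a1, a2⟩ | ⟨a1, a2⟩⟩
    · right; subst a1; exact ⟨h1, a2⟩
    · left; subst a1
      refine ⟨a0, by simpa using h1, by omega, fun t ht => by have := h5 t ht; omega⟩

lemma slot_rem {h K r : ℕ} (hh : 3 ≤ h) {lam : BPartition} (hs : IsHStrict h lam)
    (S : Slot h K r lam) (c : ℕ) : Removable h 0 lam (r, c) ↔
      1 ≤ c ∧ ((c = K + 1 ∧ lam.parts r = K + 1) ∨ (c = K ∧ K ≤ lam.parts r)) := by
  rw [removable_iff hh hs]
  obtain ⟨h1, h2, h3, h4, h5, h6⟩ := S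
  constructor
  · rintro (⟨a1, a2, a3⟩ | ⟨a0, a1, a2, a3⟩)
    · have := dvd_near a2 h1 (by omega) (by omega)
      omega
    · have := dvd_near a1 h1 (by omega) (by omega)
      omega
  · rintro ⟨a0, ⟨a1, a2⟩ | ⟨a1, a2⟩⟩
    · left; subst a1; exact ⟨a0, by simpa using h1, a2⟩
    · right; subst a1
      refine ⟨a0, h1, by omega, by omega⟩

lemma slot_upd {h K r v : ℕ} (hh : 3 ≤ h) {lam : BPartition} (hs : IsHStrict h lam)
    (S : Slot h K r lam) (v1 : K ≤ v + 1) (v2 : v ≤ K + 1) :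
    ∃ mu : BPartition, IsHStrict h mu ∧ (∀ t, mu.parts t = if t = r then v else lam.parts t) ∧
      Slot h K r mu := by
  obtain ⟨h1, h2, h3, h4, h5, h6⟩ := S
  obtain ⟨mu, a1, a2⟩ := exists_upd h lam hs r v (fun t ht => by have := h5 t ht; omega) (by
    rcases h6 with h6 | ⟨h6, h7⟩
    · omega
    · rcases Nat.eq_zero_or_pos v with h8 | h8
      · right; rw [h8, h7]; simp
      · omega)
  have e1 : mu.parts r = v := by simp [a2]
  have e2 : mu.parts (r+1) = lam.parts (r+1) := by simp [a2]
  refine ⟨mu, a1, a2, h1, h2, by omega, by omega, ?_, by omega⟩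
  intro t ht
  have : mu.parts t = lam.parts t := by rw [a2, if_neg (by omega)]
  rw [this]; exact h5 t ht

lemma slot_other {h K r v K' r' : ℕ} (hh : 3 ≤ h) {lam mu : BPartition}
    (S : Slot h K r lam) (v1 : K' ≤ v + 1) (v2 : v ≤ K' + 1)
    (hmu : ∀ t, mu.parts t = if t = r' then v else lam.parts t)
    (hk : r < r' ∧ K' + h ≤ K ∨ r' < r ∧ K + h ≤ K') : Slot h K r mu := by
  obtain ⟨h1, h2, h3, h4, h5, h6⟩ := S
  have e1 : mu.parts r = lam.parts r := by rw [hmu, if_neg (by omega)]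
  refine ⟨h1, h2, by omega, by omega, ?_, ?_⟩
  · intro t ht
    have := h5 t ht
    have := hmu t
    split_ifs at this <;> omega
  · have := hmu (r+1)
    split_ifs at this <;> omega

lemma other_row {h r : ℕ} (hh : 3 ≤ h) {lam : BPartition} (hs : IsHStrict h lam)
    (ho : ¬ Zr h (lam.parts r) ∨ (lam.parts r = 0 ∧ ∃ t, t + 1 = r ∧ lam.parts t ≤ 1)) (c : ℕ) :
    ¬ Addable h 0 lam (r, c) ∧ ¬ Removable h 0 lam (r, c) := by
  rw [addable_iff hh hs, removable_iff hh hs]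
  unfold Zr at ho
  rcases ho with ho | ⟨ho, ho'⟩
  · push Not at ho
    obtain ⟨o1, o2, o3⟩ := ho
    constructor
    · rintro (⟨a1, a2, a3 | a3, a4⟩ | ⟨a1, a2⟩)
      · subst a3; exact o1 (by simpa using a2)
      · subst a3; exact o2 (by simpa using a2)
      · subst a2; exact o2 a1
    · rintro (⟨a1, a2, a3⟩ | ⟨a0, a1, a2 | a2, a3⟩)
      · subst a3; exact o3 a2
      · subst a2; exact o1 a1
      · apply o3; rw [a2]; simpa using a1
  · constructor
    · rintro (⟨a1, a2, a3 | a3, a4⟩ | ⟨a1, a2⟩)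
      · obtain ⟨t, t1, t2⟩ := ho'
        have := a4 t t1; omega
      · have : c - 1 = 1 := by omega
        rw [this] at a2
        have := Nat.le_of_dvd (by omega) a2
        omega
      · have := Nat.le_of_dvd (by omega) a1
        omega
    · rintro (⟨a1, a2, a3⟩ | ⟨a0, a1, a2 | a2, a3⟩) <;> omega

structure Fam (h p q s : ℕ) (lam : BPartition) : Prop where
  hs : IsHStrict h lam
  pq : p < q
  qs : q < s
  sp : Slot h (2*h) p lam
  sq : Slot h h q lam
  ss : Slot h 0 s lam
  oth : ∀ r, r ≠ p → r ≠ q → r ≠ s → ¬ Zr h (lam.parts r) ∨ s < r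

lemma slot_zero {h s : ℕ} {lam : BPartition} (ss : Slot h 0 s lam) {r : ℕ} (hr : s < r) :
    lam.parts r = 0 ∧ ∃ t, t + 1 = r ∧ lam.parts t ≤ 1 := by
  have h1 := ss.below
  have h2 := parts_anti lam (show s + 1 ≤ r from hr)
  have h3 := parts_anti lam (show s ≤ r - 1 by omega)
  have h4 := ss.hi
  exact ⟨by omega, r - 1, by omega, by omega⟩

lemma Fam.add {h p q s : ℕ} (hh : 3 ≤ h) {lam : BPartition} (F : Fam h p q s lam) (r c : ℕ) :
    Addable h 0 lam (r, c) ↔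
      (r = p ∧ (c = 2*h ∧ lam.parts p + 1 = 2*h ∨ c = 2*h+1 ∧ lam.parts p ≤ 2*h)) ∨
      (r = q ∧ (c = h ∧ lam.parts q + 1 = h ∨ c = h+1 ∧ lam.parts q ≤ h)) ∨
      (r = s ∧ c = 1 ∧ lam.parts s = 0) := by
  have := F.pq
  have := F.qs
  by_cases h1 : r = p
  · subst h1; rw [slot_add hh F.hs F.sp]; omega
  by_cases h2 : r = q
  · subst h2; rw [slot_add hh F.hs F.sq]; omega
  by_cases h3 : r = s
  · subst h3; rw [slot_add hh F.hs F.ss]; omega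
  have h4 := (other_row hh F.hs ((F.oth r h1 h2 h3).imp id (slot_zero F.ss)) c).1
  simp [h4, h1, h2, h3]

lemma Fam.rem {h p q s : ℕ} (hh : 3 ≤ h) {lam : BPartition} (F : Fam h p q s lam) (r c : ℕ) :
    Removable h 0 lam (r, c) ↔
      (r = p ∧ (c = 2*h+1 ∧ lam.parts p = 2*h+1 ∨ c = 2*h ∧ 2*h ≤ lam.parts p)) ∨
      (r = q ∧ (c = h+1 ∧ lam.parts q = h+1 ∨ c = h ∧ h ≤ lam.parts q)) ∨
      (r = s ∧ c = 1 ∧ lam.parts s = 1) := by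
  have := F.pq
  have := F.qs
  by_cases h1 : r = p
  · subst h1; rw [slot_rem hh F.hs F.sp]; omega
  by_cases h2 : r = q
  · subst h2; rw [slot_rem hh F.hs F.sq]; omega
  by_cases h3 : r = s
  · subst h3; rw [slot_rem hh F.hs F.ss]; omega
  have h4 := (other_row hh F.hs ((F.oth r h1 h2 h3).imp id (slot_zero F.ss)) c).2
  simp [h4, h1, h2, h3]

lemma Fam.upd {h p q s : ℕ} (hh : 3 ≤ h) {lam : BPartition} (F : Fam h p q s lam)
    {x y z : ℕ} (x1 : 2*h ≤ x + 1) (x2 : x ≤ 2*h + 1) (y1 : h ≤ y + 1) (y2 : y ≤ h + 1)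
    (z2 : z ≤ 1) :
    ∃ mu, Fam h p q s mu ∧ mu.parts p = x ∧ mu.parts q = y ∧ mu.parts s = z ∧
      (∀ r, r ≠ p → r ≠ q → r ≠ s → mu.parts r = lam.parts r) ∧
      partsM mu + nz (lam.parts p) + nz (lam.parts q) + nz (lam.parts s) =
        partsM lam + nz x + nz y + nz z := by
  obtain ⟨hs, pq, qs, sp, sq, ss, oth⟩ := F
  obtain ⟨m1, a1, a2, a3⟩ := slot_upd hh hs sp (v := x) (by omega) (by omega)
  have a4 := slot_other hh sq x1 x2 a2 (by omega)
  have a5 := slot_other hh ss x1 x2 a2 (by omega)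
  have a6 := partsM_upd a2
  obtain ⟨m2, b1, b2, b3⟩ := slot_upd hh a1 a4 (v := y) (by omega) (by omega)
  have b4 := slot_other hh a3 y1 y2 b2 (by omega)
  have b5 := slot_other hh a5 y1 y2 b2 (by omega)
  have b6 := partsM_upd b2
  obtain ⟨m3, c1, c2, c3⟩ := slot_upd hh b1 b5 (v := z) (by omega) (by omega)
  have c4 := slot_other (K' := 0) hh b4 (by omega) (by omega) c2 (by omega)
  have c5 := slot_other (K' := 0) hh b3 (by omega) (by omega) c2 (by omega)
  have c6 := partsM_upd c2
  have e : ∀ r, r ≠ p → r ≠ q → r ≠ s → m3.parts r = lam.parts r := by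
    intro r h1 h2 h3
    rw [c2, if_neg h3, b2, if_neg h2, a2, if_neg h1]
  refine ⟨m3, ⟨c1, pq, qs, c4, c5, c3, ?_⟩, ?_, ?_, ?_, e, ?_⟩
  · intro r h1 h2 h3
    rw [e r h1 h2 h3]; exact oth r h1 h2 h3
  · rw [c2, if_neg (by omega), b2, if_neg (by omega), a2, if_pos rfl]
  · rw [c2, if_neg (by omega), b2, if_pos rfl]
  · rw [c2, if_pos rfl]
  · have e1 : m1.parts q = lam.parts q := by rw [a2, if_neg (by omega)]
    have e2 : m2.parts s = lam.parts s := by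
      rw [b2, if_neg (by omega), a2, if_neg (by omega)]
    rw [e1] at b6
    rw [e2] at c6
    calc partsM m3 + nz (lam.parts p) + nz (lam.parts q) + nz (lam.parts s)
        = (partsM m3 + nz (lam.parts s)) + nz (lam.parts p) + nz (lam.parts q) := by abel
      _ = (partsM m2 + nz (lam.parts q)) + nz z + nz (lam.parts p) := by rw [c6]; abel
      _ = (partsM m1 + nz (lam.parts p)) + nz y + nz z := by rw [b6]; abel
      _ = _ := by rw [a6]

lemma Zr_ne {h v : ℕ} (hv : ¬ Zr h v) (hh : 3 ≤ h) : v ≠ 2*h-1 ∧ v ≠ 2*h ∧ v ≠ 2*h+1 ∧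
    v ≠ h-1 ∧ v ≠ h ∧ v ≠ h+1 ∧ v ≠ 1 ∧ v ≠ 0 := by
  unfold Zr at hv
  push Not at hv
  obtain ⟨h1, h2, h3⟩ := hv
  refine ⟨?_, ?_, ?_, ?_, ?_, ?_, ?_, ?_⟩ <;> rintro rfl
  · exact h2 (by rw [show 2*h-1+1 = 2*h by omega]; exact Dvd.intro_left 2 rfl)
  · exact h1 (Dvd.intro_left 2 rfl)
  · exact h3 (Dvd.intro_left 2 rfl)
  · exact h2 (by rw [show h-1+1 = h by omega])
  · exact h1 dvd_rfl
  · exact h3 dvd_rfl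
  · exact h3 (by simp)
  · exact h1 (by simp)

lemma fam_base {h : ℕ} (hh : 3 ≤ h) {lam : BPartition} (hs : IsHStrict h lam) {ρ : Multiset ℕ}
    (hρ : ∀ v ∈ ρ, ¬ Zr h v)
    (hm : partsM lam = nz (2*h-1) + nz (h-1) + nz 1 + ρ) :
    ∃ p q s, Fam h p q s lam ∧ lam.parts p = 2*h-1 ∧ lam.parts q = h-1 ∧ lam.parts s = 1 := by
  have hmem : ∀ v, v ∈ partsM lam ↔ v = 2*h-1 ∨ v = h-1 ∨ v = 1 ∨ v ∈ ρ := by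
    intro v
    rw [hm]; simp [nz, show h - 1 ≠ 0 by omega, show 2*h-1 ≠ 0 by omega, or_assoc]
  obtain ⟨-, p, hp⟩ := mem_partsM.1 ((hmem (2*h-1)).2 (by simp))
  obtain ⟨-, q, hq⟩ := mem_partsM.1 ((hmem (h-1)).2 (by simp))
  obtain ⟨-, s, hs1⟩ := mem_partsM.1 ((hmem 1).2 (by simp))
  have n1 : ¬ h ∣ 2*h-1 := fun hd => by
    have := dvd_near hd (show h ∣ 2*h from Dvd.intro_left 2 rfl) (by omega) (by omega); omega
  have n2 : ¬ h ∣ h-1 := fun hd => by have := Nat.le_of_dvd (by omega) hd; omega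
  have n3 : ¬ h ∣ 1 := fun hd => by have := Nat.le_of_dvd (by omega) hd; omega
  have uniq : ∀ r t, lam.parts r = lam.parts t → ¬ h ∣ lam.parts t → r = t := by
    intro r t he hd
    by_contra hne
    have hpos : 0 < lam.parts t := Nat.pos_of_ne_zero (fun h0 => hd (by simp [h0]))
    rcases Nat.lt_or_gt_of_ne hne with hlt | hlt
    · exact hd (he ▸ hstrict_dvd hs hlt (by omega) hpos)
    · exact hd (hstrict_dvd hs hlt (by omega) (by omega))
  have lt_of : ∀ r t, lam.parts t < lam.parts r → r < t := by
    intro r t hl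
    by_contra hc
    have := parts_anti lam (Nat.le_of_not_lt hc)
    omega
  have all : ∀ r, r = p ∨ r = q ∨ r = s ∨ lam.parts r = 0 ∨ ¬ Zr h (lam.parts r) := by
    intro r
    rcases Nat.eq_zero_or_pos (lam.parts r) with h0 | h0
    · simp [h0]
    rcases (hmem _).1 (mem_partsM.2 ⟨h0, r, rfl⟩) with h1 | h1 | h1 | h1
    · left; exact uniq _ _ (by omega) (by rwa [hp])
    · right; left; exact uniq _ _ (by omega) (by rwa [hq])
    · right; right; left; exact uniq _ _ (by omega) (by rwa [hs1])
    · right; right; right; right; exact hρ _ h1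
  have pq := lt_of p q (by omega)
  have qs := lt_of q s (by omega)
  have val : ∀ r, (r = p ∧ lam.parts r = 2*h-1) ∨ (r = q ∧ lam.parts r = h-1) ∨
      (r = s ∧ lam.parts r = 1) ∨ lam.parts r = 0 ∨ (lam.parts r ≠ 2*h-1 ∧ lam.parts r ≠ 2*h ∧
      lam.parts r ≠ 2*h+1 ∧ lam.parts r ≠ h-1 ∧ lam.parts r ≠ h ∧ lam.parts r ≠ h+1 ∧
      lam.parts r ≠ 1 ∧ lam.parts r ≠ 0) := by
    intro r
    rcases all r with h1 | h1 | h1 | h1 | h1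
    · subst h1; omega
    · subst h1; omega
    · subst h1; omega
    · omega
    · have := Zr_ne h1 hh; omega
  refine ⟨p, q, s, ⟨hs, pq, qs, ⟨Dvd.intro_left 2 rfl, by omega, by omega, by omega, ?_, ?_⟩,
    ⟨dvd_rfl, by omega, by omega, by omega, ?_, ?_⟩,
    ⟨by simp, by omega, by omega, by omega, ?_, ?_⟩, ?_⟩, hp, hq, hs1⟩
  · intro t ht; have := val t; have := parts_anti lam (show t ≤ p by omega); omega
  · have := val (p+1); have := lam.antitone p; omega
  · intro t ht; have := val t; have := parts_anti lam (show t ≤ q by omega); omega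
  · have := val (q+1); have := lam.antitone q; omega
  · intro t ht; have := val t; have := parts_anti lam (show t ≤ s by omega); omega
  · have := val (s+1); have := lam.antitone s; omega
  · intro r h1 h2 h3
    rcases all r with h4 | h4 | h4 | h4 | h4
    · exact absurd h4 h1
    · exact absurd h4 h2
    · exact absurd h4 h3
    · exact Or.inr (lt_of _ _ (by omega))
    · exact Or.inl h4

lemma not_dvd_of {h v : ℕ} (h1 : ∃ K, h ∣ K ∧ K < v + h ∧ v < K + h ∧ v ≠ K) : ¬ h ∣ v := by
  obtain ⟨K, h1, h2, h3, h4⟩ := h1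
  intro hd
  exact h4 (dvd_near h1 hd (by omega) (by omega))

lemma fam_exists {h : ℕ} (hh : 3 ≤ h) {ρ : Multiset ℕ}
    (hρ : ∀ v ∈ ρ, ¬ Zr h v) (hc : ∀ v, ρ.count v ≤ 1) :
    ∃ p q s, p < q ∧ q < s ∧ ∃ base : ℕ → ℕ, ∀ x y z, 2*h ≤ x + 1 → x ≤ 2*h + 1 → h ≤ y + 1 →
      y ≤ h + 1 → z ≤ 1 →
      ∃ mu, Fam h p q s mu ∧ mu.parts p = x ∧ mu.parts q = y ∧ mu.parts s = z ∧
      (∀ r, r ≠ p → r ≠ q → r ≠ s → mu.parts r = base r) ∧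
      partsM mu = nz x + nz y + nz z + ρ := by
  have hz : ∀ v, Zr h v → ρ.count v = 0 := fun v hv => by
    rw [Multiset.count_eq_zero]; intro hm; exact hρ v hm hv
  obtain ⟨lam, hs, hm⟩ := exists_hstrict h (nz (2*h-1) + nz (h-1) + nz 1 + ρ) (by
    intro v hv
    simp only [nz, show h - 1 ≠ 0 by omega, show 2*h-1 ≠ 0 by omega, Multiset.mem_add, if_false,
      Multiset.mem_singleton, one_ne_zero] at hv
    rcases hv with ((hv | hv) | hv) | hv
    · omega
    · omega
    · omega
    · have := Zr_ne (hρ v hv) hh; omega) (by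
    intro v _
    simp only [nz, show h - 1 ≠ 0 by omega, show 2*h-1 ≠ 0 by omega, Multiset.count_add, if_false,
      Multiset.count_singleton, one_ne_zero]
    have h1 := hc v
    by_cases hv : Zr h v
    · have := hz v hv
      split_ifs <;> omega
    · have := Zr_ne hv hh
      split_ifs <;> omega)
  obtain ⟨p, q, s, F, e1, e2, e3⟩ := fam_base hh hs hρ hm
  refine ⟨p, q, s, F.pq, F.qs, lam.parts, ?_⟩
  intro x y z x1 x2 y1 y2 z2
  obtain ⟨mu, a1, a2, a3, a4, a5, a6⟩ := F.upd hh x1 x2 y1 y2 z2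
  refine ⟨mu, a1, a2, a3, a4, a5, ?_⟩
  rw [e1, e2, e3, hm] at a6
  have : (nz (2*h-1) + nz (h-1) + nz 1) + partsM mu =
      (nz (2*h-1) + nz (h-1) + nz 1) + (nz x + nz y + nz z + ρ) := by
    calc _ = partsM mu + nz (2*h-1) + nz (h-1) + nz 1 := by abel
      _ = _ := a6
      _ = _ := by abel
  exact add_left_cancel this

end BPartition
namespace BPartition

lemma mem_diagram {lam : BPartition} {r c : ℕ} : (r, c) ∈ diagram lam ↔ 1 ≤ c ∧ c ≤ lam.parts r :=
  Iff.rfl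

set_option maxHeartbeats 2000000 in
lemma fam_main {h : ℕ} (hh : 3 ≤ h) {ρ : Multiset ℕ}
    (hρ : ∀ v ∈ ρ, ¬ Zr h v) (hc : ∀ v, ρ.count v ≤ 1) :
    ∃ α β γ α' β' γ' : BPartition,
      (IsHStrict h α ∧ partsM α = {2*h-1, h-1, 1} + ρ ∧ ∃ x, Removable h 0 α x) ∧
      (IsHStrict h β ∧ partsM β = {2*h-1, h} + ρ ∧ ∃ x, Removable h 0 β x) ∧
      (IsHStrict h γ ∧ partsM γ = {2*h, h-1} + ρ ∧ ∃ x, Removable h 0 γ x) ∧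
      (IsHStrict h α' ∧ partsM α' = {2*h, h+1, 1} + ρ ∧ ∃ x, Addable h 0 α' x) ∧
      (IsHStrict h β' ∧ partsM β' = {2*h+1, h, 1} + ρ ∧ ∃ x, Addable h 0 β' x) ∧
      (IsHStrict h γ' ∧ partsM γ' = {2*h+1, h+1} + ρ ∧ ∃ x, Addable h 0 γ' x) ∧
      domLT α β ∧ domLT β γ ∧ domLT α' β' ∧ domLT β' γ' ∧
      psi h 0 α = α' ∧ psi h 0 β = γ' ∧ psi h 0 γ = β' := by
  obtain ⟨p, q, s, pq, qs, base, H⟩ := fam_exists hh hρ hc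
  obtain ⟨α, Fa, a1, a2, a3, a4, a5⟩ := H (2*h-1) (h-1) 1
    (by omega) (by omega) (by omega) (by omega) (by omega)
  obtain ⟨β, Fb, b1, b2, b3, b4, b5⟩ := H (2*h-1) h 0
    (by omega) (by omega) (by omega) (by omega) (by omega)
  obtain ⟨γ, Fc, c1, c2, c3, c4, c5⟩ := H (2*h) (h-1) 0
    (by omega) (by omega) (by omega) (by omega) (by omega)
  obtain ⟨α', Fd, d1, d2, d3, d4, d5⟩ := H (2*h) (h+1) 1
    (by omega) (by omega) (by omega) (by omega) (by omega)
  obtain ⟨β', Fe, e1, e2, e3, e4, e5⟩ := H (2*h+1) h 1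
    (by omega) (by omega) (by omega) (by omega) (by omega)
  obtain ⟨γ', Ff, f1, f2, f3, f4, f5⟩ := H (2*h+1) (h+1) 0
    (by omega) (by omega) (by omega) (by omega) (by omega)
  have z1 : h ≠ 0 := by omega
  have z2 : h - 1 ≠ 0 := by omega
  have z3 : 2 * h - 1 ≠ 0 := by omega
  refine ⟨α, β, γ, α', β', γ', ⟨Fa.hs, ?_, (s, 1), (Fa.rem hh _ _).2 ?_⟩,
    ⟨Fb.hs, ?_, (q, h), (Fb.rem hh _ _).2 ?_⟩, ⟨Fc.hs, ?_, (p, 2*h), (Fc.rem hh _ _).2 ?_⟩,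
    ⟨Fd.hs, ?_, (p, 2*h+1), (Fd.add hh _ _).2 ?_⟩, ⟨Fe.hs, ?_, (q, h+1), (Fe.add hh _ _).2 ?_⟩,
    ⟨Ff.hs, ?_, (s, 1), (Ff.add hh _ _).2 ?_⟩, ?_, ?_, ?_, ?_, ?_, ?_, ?_⟩
  · rw [a5]; simp [nz, z1, z2, z3]
  · omega
  · rw [b5]; simp [nz, z1, z2, z3]
  · omega
  · rw [c5]; simp [nz, z1, z2, z3]
  · omega
  · rw [d5]; simp [nz, z1, z2, z3]
  · omega
  · rw [e5]; simp [nz, z1, z2, z3]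
  · omega
  · rw [f5]; simp [nz, z1, z2, z3]
  · omega
  · apply dom_step qs
    · omega
    · omega
    · intro t t1 t2
      by_cases t3 : t = p
      · subst t3; omega
      · rw [a4 t t3 t1 t2, b4 t t3 t1 t2]
  · apply dom_step pq
    · omega
    · omega
    · intro t t1 t2
      by_cases t3 : t = s
      · subst t3; omega
      · rw [b4 t t1 t2 t3, c4 t t1 t2 t3]
  · apply dom_step pq
    · omega
    · omega
    · intro t t1 t2
      by_cases t3 : t = s
      · subst t3; omega
      · rw [d4 t t1 t2 t3, e4 t t1 t2 t3]
  · apply dom_step qs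
    · omega
    · omega
    · intro t t1 t2
      by_cases t3 : t = p
      · subst t3; omega
      · rw [e4 t t3 t1 t2, f4 t t3 t1 t2]
  · apply psi_alpha (rb := s) (b := 1) (r1 := q) (c1 := h) (r2 := q) (c2 := h+1)
      (r3 := p) (c3 := 2*h) (r4 := p) (c4 := 2*h+1) (by omega) (by omega) (by omega) (by omega)
    · rintro ⟨r, c⟩; rw [Fa.rem hh, a1, a2, a3]; clear * - hh pq qs; simp only [Prod.mk.injEq, and_true, le_refl, and_false, or_false, zero_ne_one]; omega
    · rintro ⟨r, c⟩; rw [Fa.add hh, a1, a2, a3]; clear * - hh pq qs; simp only [Prod.mk.injEq, and_true, le_refl]; omega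
    · rintro ⟨r, c⟩; rw [mem_diagram, mem_diagram]; simp only [Prod.mk.injEq]
      by_cases t1 : r = p
      · subst t1; omega
      by_cases t2 : r = q
      · subst t2; omega
      by_cases t3 : r = s
      · subst t3; omega
      rw [a4 r t1 t2 t3, d4 r t1 t2 t3]; omega
  · apply psi_beta (rb := q) (b := h) (r1 := s) (c1 := 1) (r2 := q) (c2 := h+1)
      (r3 := p) (c3 := 2*h) (r4 := p) (c4 := 2*h+1) (by omega) (by omega) (by omega) (by omega)
    · rintro ⟨r, c⟩; rw [Fb.rem hh, b1, b2, b3]; clear * - hh pq qs; simp only [Prod.mk.injEq, and_true, le_refl, and_false, or_false, zero_ne_one]; omega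
    · rintro ⟨r, c⟩; rw [Fb.add hh, b1, b2, b3]; clear * - hh pq qs; simp only [Prod.mk.injEq, and_true, le_refl]; omega
    · rintro ⟨r, c⟩; rw [mem_diagram, mem_diagram]; simp only [Prod.mk.injEq]
      by_cases t1 : r = p
      · subst t1; omega
      by_cases t2 : r = q
      · subst t2; omega
      by_cases t3 : r = s
      · subst t3; omega
      rw [b4 r t1 t2 t3, f4 r t1 t2 t3]; omega
  · apply psi_gamma (rb := p) (b := 2*h) (r1 := s) (c1 := 1) (r2 := q) (c2 := h)
      (r3 := q) (c3 := h+1) (r4 := p) (c4 := 2*h+1) (by omega) (by omega) (by omega) (by omega)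
    · rintro ⟨r, c⟩; rw [Fc.rem hh, c1, c2, c3]; clear * - hh pq qs; simp only [Prod.mk.injEq, and_true, le_refl, and_false, or_false, zero_ne_one]; omega
    · rintro ⟨r, c⟩; rw [Fc.add hh, c1, c2, c3]; clear * - hh pq qs; simp only [Prod.mk.injEq, and_true, le_refl]; omega
    · rintro ⟨r, c⟩; rw [mem_diagram, mem_diagram]; simp only [Prod.mk.injEq]
      by_cases t1 : r = p
      · subst t1; omega
      by_cases t2 : r = q
      · subst t2; omega
      by_cases t3 : r = s
      · subst t3; omega
      rw [c4 r t1 t2 t3, e4 r t1 t2 t3]; omega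

lemma sigma_tau {h : ℕ} (hh : 3 ≤ h) {σ : BPartition} (hs : IsHStrict h σ) {ρ : Multiset ℕ}
    (hρ : ∀ v ∈ ρ, ¬ Zr h v) (hm : partsM σ = {h-1} + ρ) :
    IsHStrict h (psi h 0 σ) ∧ partsM (psi h 0 σ) = {h+1, 1} + ρ := by
  have hmem : ∀ v, v ∈ partsM σ ↔ v = h-1 ∨ v ∈ ρ := by
    intro v
    rw [hm]; simp
  obtain ⟨-, q, hq⟩ := mem_partsM.1 ((hmem (h-1)).2 (by simp))
  have hex : ∃ s, σ.parts s = 0 := by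
    obtain ⟨s, hs⟩ := Infinite.exists_notMem_finset σ.parts.support
    exact ⟨s, by simpa using hs⟩
  obtain ⟨s, hs0, hs1⟩ : ∃ s, σ.parts s = 0 ∧ ∀ t, t < s → σ.parts t ≠ 0 := by
    classical
    exact ⟨Nat.find hex, Nat.find_spec hex, fun t ht => Nat.find_min hex ht⟩
  have n2 : ¬ h ∣ h-1 := fun hd => by have := Nat.le_of_dvd (by omega) hd; omega
  have lt_of : ∀ r t, σ.parts t < σ.parts r → r < t := by
    intro r t hl
    by_contra hc
    have := parts_anti σ (Nat.le_of_not_lt hc)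
    omega
  have uniq : ∀ r, σ.parts r = h-1 → r = q := by
    intro r he
    by_contra hne
    rcases Nat.lt_or_gt_of_ne hne with hlt | hlt
    · exact n2 (he ▸ hstrict_dvd hs hlt (by omega) (by omega))
    · exact n2 (hq ▸ hstrict_dvd hs hlt (by omega) (by omega))
  have all : ∀ r, r = q ∨ σ.parts r = 0 ∨ ¬ Zr h (σ.parts r) := by
    intro r
    rcases Nat.eq_zero_or_pos (σ.parts r) with h0 | h0
    · simp [h0]
    rcases (hmem _).1 (mem_partsM.2 ⟨h0, r, rfl⟩) with h1 | h1
    · left; exact uniq _ h1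
    · right; right; exact hρ _ h1
  have qs := lt_of q s (by omega)
  have val : ∀ r, (r = q ∧ σ.parts r = h-1) ∨ σ.parts r = 0 ∨
      (σ.parts r ≠ h-1 ∧ σ.parts r ≠ h ∧ σ.parts r ≠ h+1 ∧ σ.parts r ≠ 1 ∧ σ.parts r ≠ 0) := by
    intro r
    rcases all r with h1 | h1 | h1
    · subst h1; omega
    · omega
    · have := Zr_ne h1 hh; omega
  have sq : Slot h h q σ := by
    refine ⟨dvd_rfl, by omega, by omega, by omega, ?_, ?_⟩
    · intro t ht; have := val t; have := parts_anti σ (show t ≤ q by omega); omega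
    · have := val (q+1); have := σ.antitone q; omega
  have ss : Slot h 0 s σ := by
    refine ⟨by simp, by omega, by omega, by omega, ?_, ?_⟩
    · intro t ht; have := val t; have := hs1 t (by omega); omega
    · have := σ.antitone s; omega
  have oth : ∀ r, r ≠ q → r ≠ s → ¬ Zr h (σ.parts r) ∨ s < r := by
    intro r h1 h2
    rcases all r with h3 | h3 | h3
    · exact absurd h3 h1
    · right
      by_contra hc
      exact hs1 r (by omega) h3
    · exact Or.inl h3
  obtain ⟨m1, a1, a2, a3⟩ := slot_upd hh hs sq (v := h+1) (by omega) (by omega)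
  have a5 := slot_other (K' := h) hh ss (by omega) (by omega) a2 (by omega)
  have a6 := partsM_upd a2
  obtain ⟨m2, b1, b2, b3⟩ := slot_upd hh a1 a5 (v := 1) (by omega) (by omega)
  have b6 := partsM_upd b2
  have e1 : psi h 0 σ = m2 := by
    apply psi_ppp (r1 := s) (c1 := 1) (r2 := q) (c2 := h) (r3 := q) (c3 := h+1)
      (by omega) (by omega)
    · rintro ⟨r, c⟩
      by_cases t2 : r = q
      · subst t2; rw [slot_rem hh hs sq]; omega
      by_cases t3 : r = s
      · subst t3; rw [slot_rem hh hs ss]; omega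
      exact (other_row hh hs ((oth r t2 t3).imp id (slot_zero ss)) c).2
    · rintro ⟨r, c⟩
      simp only [Prod.mk.injEq]
      by_cases t2 : r = q
      · subst t2; rw [slot_add hh hs sq]; omega
      by_cases t3 : r = s
      · subst t3; rw [slot_add hh hs ss]; omega
      have := (other_row hh hs ((oth r t2 t3).imp id (slot_zero ss)) c).1
      simp [this, t2, t3]
    · rintro ⟨r, c⟩; rw [mem_diagram, mem_diagram, b2]; simp only [Prod.mk.injEq]
      by_cases t3 : r = s
      · subst t3; rw [if_pos rfl]; omega
      rw [if_neg t3, a2]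
      by_cases t2 : r = q
      · subst t2; rw [if_pos rfl]; omega
      rw [if_neg t2]; omega
  rw [e1]
  refine ⟨b1, ?_⟩
  have e2 : m1.parts s = 0 := by rw [a2, if_neg (by omega), hs0]
  rw [e2] at b6
  rw [hq, hm] at a6
  simp only [nz, show h - 1 ≠ 0 by omega, show h + 1 ≠ 0 by omega, if_false, if_true, one_ne_zero,
    add_zero] at a6 b6
  have a7 : {h-1} + partsM m1 = {h-1} + ({h+1} + ρ) := by
    rw [add_comm, a6]; abel
  rw [b6, add_left_cancel a7]
  simp only [Multiset.insert_eq_cons, ← Multiset.singleton_add]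
  abel

end BPartition
namespace BPartition

lemma Zr_shift {h u : ℕ} (hu : 0 < u) : Zr h (u + h) ↔ Zr h u := by
  unfold Zr
  rw [show u + h + 1 = u + 1 + h by omega, show u + h - 1 = u - 1 + h by omega]
  simp

lemma Zr_pair {h a b : ℕ} (hh : 3 ≤ h) (ha : 0 < a) (hb : 0 < b) (hab : a + b = h)
    (hz : Zr h a) : (a = 1 ∧ b = h - 1) ∨ (a = h - 1 ∧ b = 1) := by
  rcases hz with hz | hz | hz
  · have := Nat.le_of_dvd ha hz; omega
  · have := Nat.le_of_dvd (by omega) hz; omega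
  · rcases Nat.eq_zero_or_pos (a - 1) with h1 | h1
    · omega
    · have := Nat.le_of_dvd h1 hz; omega

lemma Zr_one {h : ℕ} : Zr h 1 := Or.inr (Or.inr (by simp))
lemma Zr_h {h : ℕ} : Zr h h := Or.inl dvd_rfl
lemma Zr_hm {h : ℕ} (hh : 3 ≤ h) : Zr h (h-1) :=
  Or.inr (Or.inl (by rw [show h - 1 + 1 = h by omega]))
lemma Zr_hp {h : ℕ} : Zr h (h+1) := Or.inr (Or.inr (by simp))
lemma Zr_2hm {h : ℕ} (hh : 3 ≤ h) : Zr h (2*h-1) :=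
  Or.inr (Or.inl (by rw [show 2 * h - 1 + 1 = 2 * h by omega]; exact Dvd.intro_left 2 rfl))
lemma Zr_2hp {h : ℕ} : Zr h (2*h+1) := Or.inr (Or.inr (Dvd.intro_left 2 rfl))

lemma split_step {h : ℕ} (hh : 3 ≤ h) {X ρ : Multiset ℕ} {lam nu : BPartition}
    (hX : ∀ v ∈ X, 0 < v ∧ Zr h v) (hρ : ∀ v ∈ ρ, 0 < v ∧ ¬ Zr h v)
    (hM : partsM nu = X + ρ) (st : barStep h lam nu) :
    ∃ X' ρ', partsM lam = X' + ρ' ∧ (∀ v ∈ X', 0 < v ∧ Zr h v) ∧ (∀ v ∈ ρ', 0 < v ∧ ¬ Zr h v) ∧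
      (X' = X ∨ (ρ' = ρ ∧ (X' = h ::ₘ X ∨ (∃ u ∈ X, X' = (u + h) ::ₘ X.erase u) ∨
        X' = 1 ::ₘ (h-1) ::ₘ X))) := by
  obtain ⟨v, -, ⟨h1, h2, h3⟩ | ⟨h1, h2, h3⟩ | ⟨a, b, h1, h2, h3, -, h5⟩⟩ := st
  · subst h1
    refine ⟨v ::ₘ X, ρ, ?_, ?_, hρ, Or.inr ⟨rfl, Or.inl rfl⟩⟩
    · rw [Multiset.cons_add, ← hM, h3, Multiset.cons_erase h2]
    · intro w hw
      rcases Multiset.mem_cons.1 hw with rfl | hw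
      · exact ⟨by omega, Zr_h⟩
      · exact hX w hw
  · obtain ⟨u, rfl⟩ : ∃ u, v = u + h := ⟨v - h, by omega⟩
    rw [Nat.add_sub_cancel] at h3
    have hu : u ∈ X + ρ := by rw [← hM, h3]; simp
    have e1 : partsM lam = (u + h) ::ₘ (X + ρ).erase u := by
      rw [← hM, h3, Multiset.erase_cons_head, Multiset.cons_erase h2]
    by_cases hx : u ∈ X
    · refine ⟨(u + h) ::ₘ X.erase u, ρ, ?_, ?_, hρ, Or.inr ⟨rfl, Or.inr (Or.inl ⟨u, hx, rfl⟩)⟩⟩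
      · rw [e1, Multiset.erase_add_left_pos _ hx, Multiset.cons_add]
      · intro w hw
        rcases Multiset.mem_cons.1 hw with rfl | hw
        · exact ⟨by omega, (Zr_shift (hX u hx).1).2 (hX u hx).2⟩
        · exact hX w (Multiset.mem_of_mem_erase hw)
    · have hr : u ∈ ρ := (Multiset.mem_add.1 hu).resolve_left hx
      refine ⟨X, (u + h) ::ₘ ρ.erase u, ?_, hX, ?_, Or.inl rfl⟩
      · rw [e1, Multiset.erase_add_right_pos _ hr, Multiset.add_cons]
      · intro w hw
        rcases Multiset.mem_cons.1 hw with rfl | hw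
        · exact ⟨by omega, fun hz => (hρ u hr).2 ((Zr_shift (hρ u hr).1).1 hz)⟩
        · exact hρ w (Multiset.mem_of_mem_erase hw)
  · have ha := partsM_pos h2
    have hb := partsM_pos (Multiset.mem_of_mem_erase h3)
    have e1 : partsM lam = a ::ₘ b ::ₘ (X + ρ) := by
      rw [← hM, h5, Multiset.cons_erase h3, Multiset.cons_erase h2]
    by_cases hz : Zr h a
    · refine ⟨1 ::ₘ (h-1) ::ₘ X, ρ, ?_, ?_, hρ, Or.inr ⟨rfl, Or.inr (Or.inr rfl)⟩⟩
      · rw [e1]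
        rcases Zr_pair hh ha hb h1 hz with ⟨rfl, rfl⟩ | ⟨rfl, rfl⟩
        · simp
        · rw [Multiset.cons_swap]; simp
      · intro w hw
        rcases Multiset.mem_cons.1 hw with rfl | hw
        · exact ⟨by omega, Zr_one⟩
        rcases Multiset.mem_cons.1 hw with rfl | hw
        · exact ⟨by omega, Zr_hm hh⟩
        · exact hX w hw
    · have hzb : ¬ Zr h b := by
        intro hzb
        rcases Zr_pair hh hb ha (by omega) hzb with ⟨rfl, rfl⟩ | ⟨rfl, rfl⟩
        · exact hz (Zr_hm hh)
        · exact hz Zr_one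
      refine ⟨X, a ::ₘ b ::ₘ ρ, ?_, hX, ?_, Or.inl rfl⟩
      · rw [e1]; simp
      · intro w hw
        rcases Multiset.mem_cons.1 hw with rfl | hw
        · exact ⟨by omega, hz⟩
        rcases Multiset.mem_cons.1 hw with rfl | hw
        · exact ⟨by omega, hzb⟩
        · exact hρ w hw

lemma not_dvd_k {h v : ℕ} (k : ℕ) (h1 : k * h < v) (h2 : v < k * h + h) : ¬ h ∣ v := by
  intro hd
  have := dvd_near hd (Dvd.intro_left k rfl) (by omega) (by omega)
  omega

lemma nodup_two {h : ℕ} {lam : BPartition} (hs : IsHStrict h lam) {X ρ : Multiset ℕ}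
    (hM : partsM lam = X + ρ) {v : ℕ} (hv : ¬ h ∣ v) : X.count v ≤ 1 := by
  have := hstrict_count hs hv
  rw [hM, Multiset.count_add] at this
  omega

lemma sigma_class {h : ℕ} (hh : 3 ≤ h) {ρ : Multiset ℕ} {σ lam : BPartition}
    (hρ : ∀ v ∈ ρ, 0 < v ∧ ¬ Zr h v) (hM : partsM σ = {h-1} + ρ)
    (hb : InBlock h σ 2 lam) {x : ℕ × ℕ} (hx : Removable h 0 lam x) :
    partsM lam = {2*h-1, h-1, 1} + ρ ∨ partsM lam = {2*h-1, h} + ρ ∨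
      partsM lam = {2*h, h-1} + ρ := by
  obtain ⟨hs, -, nu, s1, m, s2, hms⟩ := hb
  have hms : m = σ := hms
  subst hms
  have hsn : IsHStrict h nu := s1.choose_spec.1
  obtain ⟨X1, ρ1, e1, x1, r1, c1⟩ := split_step hh (X := {h-1}) (by
    intro v hv; rw [Multiset.mem_singleton] at hv; subst hv
    exact ⟨by omega, Zr_hm hh⟩) hρ hM s2
  obtain ⟨X2, ρ2, e2, x2, r2, c2⟩ := split_step hh x1 r1 e1 s1
  have n1 : ¬ h ∣ h - 1 := not_dvd_k 0 (by omega) (by omega)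
  have n2 : ¬ h ∣ h - 1 - 1 := not_dvd_k 0 (by omega) (by omega)
  have n3 : ¬ h ∣ 2*h - 1 := not_dvd_k 1 (by omega) (by omega)
  have n4 : ¬ h ∣ 2*h - 1 - 1 := not_dvd_k 1 (by omega) (by omega)
  have n5 : ¬ h ∣ 3*h - 1 := not_dvd_k 2 (by omega) (by omega)
  have n6 : ¬ h ∣ 3*h - 1 - 1 := not_dvd_k 2 (by omega) (by omega)
  have k1 := nodup_two hsn e1 n1
  have k2 := nodup_two hs e2 n1
  have P : ∃ v ∈ X2, h ∣ v - 1 ∨ (h ∣ v ∧ v - 1 ∉ X2) := by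
    obtain ⟨v, hv, hv2⟩ := has_rem hh hs hx
    rw [e2] at hv hv2
    have hz : Zr h v := by
      rcases hv2 with h1 | h1
      · exact Or.inr (Or.inr h1)
      · exact Or.inl h1.1
    refine ⟨v, (Multiset.mem_add.1 hv).resolve_right fun h1 => (r2 v h1).2 hz, ?_⟩
    exact hv2.imp id fun h1 => ⟨h1.1, fun h2 => h1.2 (Multiset.mem_add.2 (Or.inl h2))⟩
  have hne : h ≠ h - 1 := by omega
  have hne2 : h - 1 ≠ h := by omega
  have q1 : h - 1 + h = 2*h-1 := by omega
  have q2 : h + h = 2*h := by omega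
  have q3 : 2*h-1 + h = 3*h-1 := by omega
  have A1 : X2 ≠ {h-1} := by rintro rfl; simp [n1, n2] at P
  have A2 : X2 ≠ h ::ₘ {h-1} := by rintro rfl; simp [n1, n2] at P
  have A3 : X2 ≠ {2*h-1} := by rintro rfl; simp [n3, n4] at P
  have A4 : X2 ≠ {3*h-1} := by rintro rfl; simp [n5, n6] at P
  have A5 : X2 ≠ h ::ₘ h ::ₘ {h-1} := by rintro rfl; simp [n1, n2] at P
  have fin : ∀ Y : Multiset ℕ, ρ2 = ρ → X2 = Y → partsM lam = Y + ρ := by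
    rintro Y rfl rfl; exact e2
  rcases c1 with c1 | ⟨d1, c1 | ⟨u, hu, c1⟩ | c1⟩
  · subst c1
    rcases c2 with c2 | ⟨d2, c2 | ⟨u, hu, c2⟩ | c2⟩
    · exact absurd c2 A1
    · exact absurd c2 A2
    · rw [Multiset.mem_singleton] at hu; subst hu
      rw [q1] at c2
      exact absurd (by simpa using c2) A3
    · rw [c2] at k2; simp [Multiset.count_cons] at k2 <;> omega
  · subst d1
    subst c1
    rcases c2 with c2 | ⟨d2, c2 | ⟨u, hu, c2⟩ | c2⟩
    · exact absurd c2 A2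
    · exact absurd c2 A5
    · simp only [Multiset.mem_cons, Multiset.mem_singleton] at hu
      rcases hu with rfl | rfl
      · rw [q2, Multiset.erase_cons_head] at c2
        exact Or.inr (Or.inr (fin _ d2 c2))
      · rw [q1, Multiset.erase_cons_tail _ hne] at c2
        exact Or.inr (Or.inl (fin _ d2 (by rw [c2]; simp)))
    · rw [c2] at k2; simp [Multiset.count_cons] at k2 <;> omega
  · subst d1
    rw [Multiset.mem_singleton] at hu; subst hu
    have c1 : X1 = {2*h-1} := by rw [c1, q1]; simp
    subst c1
    rcases c2 with c2 | ⟨d2, c2 | ⟨u, hu, c2⟩ | c2⟩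
    · exact absurd c2 A3
    · exact Or.inr (Or.inl (fin _ d2 (by rw [c2]; exact Multiset.cons_swap _ _ _)))
    · rw [Multiset.mem_singleton] at hu; subst hu
      rw [q3] at c2
      exact absurd (by simpa using c2) A4
    · refine Or.inl (fin _ d2 ?_)
      rw [c2]
      simp only [Multiset.insert_eq_cons, ← Multiset.singleton_add]
      abel
  · rw [c1] at k1; simp [Multiset.count_cons] at k1 <;> omega

lemma tau_class {h : ℕ} (hh : 3 ≤ h) {ρ : Multiset ℕ} {τ lam : BPartition}
    (hρ : ∀ v ∈ ρ, 0 < v ∧ ¬ Zr h v) (hM : partsM τ = {h+1, 1} + ρ)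
    (hb : InBlock h τ 2 lam) {x : ℕ × ℕ} (hx : Addable h 0 lam x) :
    partsM lam = {2*h, h+1, 1} + ρ ∨ partsM lam = {2*h+1, h, 1} + ρ ∨
      partsM lam = {2*h+1, h+1} + ρ := by
  obtain ⟨hs, -, nu, s1, m, s2, hms⟩ := hb
  have hms : m = τ := hms
  subst hms
  have hsn : IsHStrict h nu := s1.choose_spec.1
  obtain ⟨X1, ρ1, e1, x1, r1, c1⟩ := split_step hh (X := {h+1, 1}) (by
    intro v hv
    simp only [Multiset.insert_eq_cons, Multiset.mem_cons, Multiset.mem_singleton] at hv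
    rcases hv with rfl | rfl
    · exact ⟨by omega, Zr_hp⟩
    · exact ⟨by omega, Zr_one⟩) hρ hM s2
  obtain ⟨X2, ρ2, e2, x2, r2, c2⟩ := split_step hh x1 r1 e1 s1
  have n0 : ¬ h ∣ 1 := not_dvd_k 0 (by omega) (by omega)
  have n1 : ¬ h ∣ h + 1 := not_dvd_k 1 (by omega) (by omega)
  have n2 : ¬ h ∣ h + 1 + 1 := not_dvd_k 1 (by omega) (by omega)
  have n3 : ¬ h ∣ 2*h + 1 := not_dvd_k 2 (by omega) (by omega)
  have n4 : ¬ h ∣ 2*h + 1 + 1 := not_dvd_k 2 (by omega) (by omega)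
  have n5 : ¬ h ∣ 3*h + 1 := not_dvd_k 3 (by omega) (by omega)
  have n6 : ¬ h ∣ 3*h + 1 + 1 := not_dvd_k 3 (by omega) (by omega)
  have n7 : ¬ h ∣ 1 + 1 := not_dvd_k 0 (by omega) (by omega)
  have n8 : ¬ h ∣ 2 := not_dvd_k 0 (by omega) (by omega)
  have k1 := nodup_two hsn e1 n0
  have k2 := nodup_two hs e2 n0
  have k3 := nodup_two hsn e1 n1
  have k4 := nodup_two hs e2 n1
  have P : 1 ∉ X2 ∨ ∃ v ∈ X2, h ∣ v + 1 ∨ (h ∣ v ∧ v + 1 ∉ X2) := by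
    rcases has_add hh hs hx with h1 | ⟨v, hv, hv2⟩
    · left; rw [e2] at h1; exact fun h2 => h1 (Multiset.mem_add.2 (Or.inl h2))
    right
    rw [e2] at hv hv2
    have hz : Zr h v := by
      rcases hv2 with h1 | h1
      · exact Or.inr (Or.inl h1)
      · exact Or.inl h1.1
    refine ⟨v, (Multiset.mem_add.1 hv).resolve_right fun h1 => (r2 v h1).2 hz, ?_⟩
    exact hv2.imp id fun h1 => ⟨h1.1, fun h2 => h1.2 (Multiset.mem_add.2 (Or.inl h2))⟩
  have w1 : h ≠ h + 1 := by omega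
  have w2 : h ≠ 1 := by omega
  have w3 : h + 1 ≠ 1 := by omega
  have w4 : 2*h+1 ≠ 1 := by omega
  have q1 : h + 1 + h = 2*h+1 := by omega
  have q2 : h + h = 2*h := by omega
  have q3 : 2*h+1 + h = 3*h+1 := by omega
  have q4 : 1 + h = h + 1 := by omega
  have A1 : X2 ≠ {h+1, 1} := by rintro rfl; simp [n0, n1, n2, n7, n8] at P
  have A2 : X2 ≠ h ::ₘ {h+1, 1} := by rintro rfl; simp [n0, n1, n2, n7, n8] at P
  have A3 : X2 ≠ {2*h+1, 1} := by rintro rfl; simp [n3, n4, n0, n7, n8] at P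
  have A4 : X2 ≠ {3*h+1, 1} := by rintro rfl; simp [n5, n6, n0, n7, n8] at P
  have A5 : X2 ≠ h ::ₘ h ::ₘ {h+1, 1} := by rintro rfl; simp [n0, n1, n2, n7, n8] at P
  have fin : ∀ Y : Multiset ℕ, ρ2 = ρ → X2 = Y → partsM lam = Y + ρ := by
    rintro Y rfl rfl; exact e2
  simp only [Multiset.insert_eq_cons] at *
  rcases c1 with c1 | ⟨d1, c1 | ⟨u, hu, c1⟩ | c1⟩
  · subst c1
    rcases c2 with c2 | ⟨d2, c2 | ⟨u, hu, c2⟩ | c2⟩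
    · exact absurd c2 A1
    · exact absurd c2 A2
    · simp only [Multiset.mem_cons, Multiset.mem_singleton] at hu
      rcases hu with rfl | rfl
      · rw [q1, Multiset.erase_cons_head] at c2
        exact absurd c2 A3
      · rw [q4, Multiset.erase_cons_tail _ w3] at c2
        rw [c2] at k4; simp [Multiset.count_cons] at k4 <;> omega
    · rw [c2] at k2; simp [Multiset.count_cons] at k2 <;> omega
  · subst d1
    subst c1
    rcases c2 with c2 | ⟨d2, c2 | ⟨u, hu, c2⟩ | c2⟩
    · exact absurd c2 A2
    · exact absurd c2 A5
    · simp only [Multiset.mem_cons, Multiset.mem_singleton] at hu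
      rcases hu with rfl | rfl | rfl
      · rw [q2, Multiset.erase_cons_head] at c2
        exact Or.inl (fin _ d2 c2)
      · rw [q1, Multiset.erase_cons_tail _ w1, Multiset.erase_cons_head] at c2
        exact Or.inr (Or.inl (fin _ d2 c2))
      · rw [q4, Multiset.erase_cons_tail _ w2, Multiset.erase_cons_tail _ w3] at c2
        rw [c2] at k4; simp [Multiset.count_cons] at k4 <;> omega
    · rw [c2] at k2; simp [Multiset.count_cons] at k2 <;> omega
  · subst d1
    simp only [Multiset.mem_cons, Multiset.mem_singleton] at hu
    rcases hu with rfl | rfl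
    · rw [q1, Multiset.erase_cons_head] at c1
      subst c1
      rcases c2 with c2 | ⟨d2, c2 | ⟨u, hu, c2⟩ | c2⟩
      · exact absurd c2 A3
      · exact Or.inr (Or.inl (fin _ d2 (by rw [c2]; exact Multiset.cons_swap _ _ _)))
      · simp only [Multiset.mem_cons, Multiset.mem_singleton] at hu
        rcases hu with rfl | rfl
        · rw [q3, Multiset.erase_cons_head] at c2
          exact absurd c2 A4
        · rw [q4, Multiset.erase_cons_tail _ w4] at c2
          exact Or.inr (Or.inr (fin _ d2 (by rw [c2, Multiset.cons_swap]; simp)))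
      · rw [c2] at k2; simp [Multiset.count_cons] at k2 <;> omega
    · rw [q4, Multiset.erase_cons_tail _ w3] at c1
      rw [c1] at k3; simp [Multiset.count_cons] at k3 <;> omega
  · rw [c1] at k1; simp [Multiset.count_cons] at k1 <;> omega

end BPartition
namespace BPartition

lemma exists_mid {h : ℕ} {X ρ : Multiset ℕ}
    (hX : ∀ v ∈ X, 0 < v ∧ Zr h v) (hn : X.Nodup) (hρ : ∀ v ∈ ρ, 0 < v ∧ ¬ Zr h v)
    (hc : ∀ v, ρ.count v ≤ 1) : ∃ lam, IsHStrict h lam ∧ partsM lam = X + ρ := by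
  apply exists_hstrict
  · intro v hv
    rcases Multiset.mem_add.1 hv with h1 | h1
    · exact (hX v h1).1
    · exact (hρ v h1).1
  · intro v _
    rw [Multiset.count_add]
    have h1 := hc v
    have h2 := Multiset.nodup_iff_count_le_one.1 hn v
    by_cases hz : Zr h v
    · have : ρ.count v = 0 := Multiset.count_eq_zero.2 fun hm => (hρ v hm).2 hz
      omega
    · have : X.count v = 0 := Multiset.count_eq_zero.2 fun hm => hz (hX v hm).2
      omega

lemma bs_h {h : ℕ} {lam mu : BPartition} (hs : IsHStrict h mu)
    (he : partsM lam = h ::ₘ partsM mu) : barStep h lam mu :=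
  ⟨h, hs, Or.inl ⟨rfl, by simp [he], by simp [he]⟩⟩

lemma bs_v {h u : ℕ} {lam mu : BPartition} {Y : Multiset ℕ} (hu : 0 < u) (hs : IsHStrict h mu)
    (he : partsM lam = (u + h) ::ₘ Y) (hm : partsM mu = u ::ₘ Y) : barStep h lam mu :=
  ⟨u + h, hs, Or.inr (Or.inl ⟨by omega, by simp [he], by simp [he, hm]⟩)⟩

lemma bs_p {h : ℕ} {lam mu : BPartition} (hh : 3 ≤ h) (hs : IsHStrict h mu)
    (he : partsM lam = 1 ::ₘ (h-1) ::ₘ partsM mu) : barStep h lam mu :=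
  ⟨max 1 (h-1), hs, Or.inr (Or.inr ⟨1, h-1, by omega, by simp [he], by simp [he], rfl,
    by simp [he]⟩)⟩

lemma two_chain {h : ℕ} {lam mu nu : BPartition} (hs : IsHStrict h lam) (hc : IsBarCore h nu)
    (h1 : barStep h lam mu) (h2 : barStep h mu nu) : InBlock h nu 2 lam :=
  ⟨hs, hc, mu, h1, nu, h2, rfl⟩

lemma sigma_conv {h : ℕ} (hh : 3 ≤ h) {ρ : Multiset ℕ} {σ lam : BPartition}
    (hρ : ∀ v ∈ ρ, 0 < v ∧ ¬ Zr h v) (hc : ∀ v, ρ.count v ≤ 1) (hM : partsM σ = {h-1} + ρ)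
    (hσ : IsBarCore h σ) (hs : IsHStrict h lam)
    (hl : partsM lam = {2*h-1, h-1, 1} + ρ ∨ partsM lam = {2*h-1, h} + ρ ∨
      partsM lam = {2*h, h-1} + ρ) : InBlock h σ 2 lam := by
  have q1 : 2*h-1 = h - 1 + h := by omega
  have q2 : 2*h = h + h := by omega
  obtain ⟨m1, a1, a2⟩ := exists_mid (X := {2*h-1}) (by
    intro v hv; rw [Multiset.mem_singleton] at hv; subst hv
    exact ⟨by omega, Zr_2hm hh⟩) (by simp) hρ hc
  obtain ⟨m2, b1, b2⟩ := exists_mid (X := {h, h-1}) (by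
    intro v hv
    simp only [Multiset.insert_eq_cons, Multiset.mem_cons, Multiset.mem_singleton] at hv
    rcases hv with rfl | rfl
    · exact ⟨by omega, Zr_h⟩
    · exact ⟨by omega, Zr_hm hh⟩) (by simp; omega) hρ hc
  have s1 : barStep h m1 σ := bs_v (u := h-1) (Y := ρ) (by omega) hσ.1
    (by rw [a2, q1, Multiset.singleton_add]) (by rw [hM, Multiset.singleton_add])
  have s2 : barStep h m2 σ := bs_h hσ.1 (by rw [b2, hM]; simp)
  rcases hl with hl | hl | hl
  · refine two_chain hs hσ (bs_p hh a1 ?_) s1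
    rw [hl, a2]
    simp only [Multiset.insert_eq_cons, ← Multiset.singleton_add]
    abel
  · refine two_chain hs hσ (bs_h a1 ?_) s1
    rw [hl, a2]
    simp only [Multiset.insert_eq_cons, ← Multiset.singleton_add]
    abel
  · refine two_chain hs hσ (bs_v (u := h) (Y := {h-1} + ρ) (by omega) b1 ?_ ?_) s2
    · rw [hl, q2]; simp
    · rw [b2]; simp

lemma tau_conv {h : ℕ} (hh : 3 ≤ h) {ρ : Multiset ℕ} {τ lam : BPartition}
    (hρ : ∀ v ∈ ρ, 0 < v ∧ ¬ Zr h v) (hc : ∀ v, ρ.count v ≤ 1) (hM : partsM τ = {h+1, 1} + ρ)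
    (hτ : IsBarCore h τ) (hs : IsHStrict h lam)
    (hl : partsM lam = {2*h, h+1, 1} + ρ ∨ partsM lam = {2*h+1, h, 1} + ρ ∨
      partsM lam = {2*h+1, h+1} + ρ) : InBlock h τ 2 lam := by
  have q1 : 2*h+1 = h + 1 + h := by omega
  have q2 : 2*h = h + h := by omega
  obtain ⟨m1, a1, a2⟩ := exists_mid (X := {2*h+1, 1}) (by
    intro v hv
    simp only [Multiset.insert_eq_cons, Multiset.mem_cons, Multiset.mem_singleton] at hv
    rcases hv with rfl | rfl
    · exact ⟨by omega, Zr_2hp⟩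
    · exact ⟨by omega, Zr_one⟩) (by simp; omega) hρ hc
  obtain ⟨m2, b1, b2⟩ := exists_mid (X := {h, h+1, 1}) (by
    intro v hv
    simp only [Multiset.insert_eq_cons, Multiset.mem_cons, Multiset.mem_singleton] at hv
    rcases hv with rfl | rfl | rfl
    · exact ⟨by omega, Zr_h⟩
    · exact ⟨by omega, Zr_hp⟩
    · exact ⟨by omega, Zr_one⟩) (by simp; omega) hρ hc
  have s1 : barStep h m1 τ := bs_v (u := h+1) (Y := {1} + ρ) (by omega) hτ.1
    (by rw [a2, q1]; simp) (by rw [hM]; simp)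
  have s2 : barStep h m2 τ := bs_h hτ.1 (by rw [b2, hM]; simp)
  rcases hl with hl | hl | hl
  · refine two_chain hs hτ (bs_v (u := h) (Y := {h+1, 1} + ρ) (by omega) b1 ?_ ?_) s2
    · rw [hl, q2]; simp
    · rw [b2]; simp
  · refine two_chain hs hτ (bs_h a1 ?_) s1
    rw [hl, a2]
    simp only [Multiset.insert_eq_cons, ← Multiset.singleton_add]
    abel
  · refine two_chain hs hτ (bs_v (u := 1) (Y := {2*h+1} + ρ) (by omega) a1 ?_ ?_) s1
    · rw [hl, show 1 + h = h + 1 by omega]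
      simp only [Multiset.insert_eq_cons, ← Multiset.singleton_add]
      abel
    · rw [a2]
      simp only [Multiset.insert_eq_cons, ← Multiset.singleton_add]
      abel

lemma tau_core {h : ℕ} (hh : 3 ≤ h) {ρ : Multiset ℕ} (hρ : ∀ v ∈ ρ, 0 < v ∧ ¬ Zr h v)
    (hc : CoreP h ({h-1} + ρ)) : CoreP h ({h+1, 1} + ρ) := by
  have n0 : ¬ h ∣ 1 := not_dvd_k 0 (by omega) (by omega)
  have n1 : ¬ h ∣ h + 1 := not_dvd_k 1 (by omega) (by omega)
  have mem : ∀ v, v ∈ ({h+1, 1} + ρ : Multiset ℕ) ↔ v = h+1 ∨ v = 1 ∨ v ∈ ρ := by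
    intro v; simp [or_assoc]
  have ne : ∀ v ∈ ρ, v ≠ 2*h-1 ∧ v ≠ 2*h ∧ v ≠ 2*h+1 ∧
    v ≠ h-1 ∧ v ≠ h ∧ v ≠ h+1 ∧ v ≠ 1 ∧ v ≠ 0 := fun v hv => Zr_ne (hρ v hv).2 hh
  constructor
  · intro v hv
    rcases (mem v).1 hv with rfl | rfl | hv
    · exact n1
    · exact n0
    · exact fun hd => (hρ v hv).2 (Or.inl hd)
  · intro v hv hlt
    rcases (mem v).1 hv with rfl | rfl | hv
    · rw [mem]; omega
    · omega
    · have := hc.down v (by simp [hv]) hlt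
      rw [Multiset.mem_add, Multiset.mem_singleton] at this
      have := ne v hv
      rw [mem]
      right; right
      refine Or.resolve_left ‹_› ?_
      omega
  · intro a ha b hb hab
    rcases (mem a).1 ha with ha | ha | ha <;> rcases (mem b).1 hb with hb | hb | hb
    all_goals first
      | omega
      | (have := ne _ hb; omega)
      | (have := ne _ ha; omega)
      | exact hc.pair a (by simp [ha]) b (by simp [hb]) hab

end BPartition
open BPartition in
/-- In a [2:3]-pair of residue 0: there are exactly three exceptional partitions
α ◁ β ◁ γ in P_{σ,2} and exactly three exceptional partitions α̂ ◁ β̂ ◁ γ̂ in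
P_{τ,2}, and ψ_0(α) = α̂, ψ_0(β) = γ̂, ψ_0(γ) = β̂. -/
theorem stmt18 (n h : ℕ) (hn : 1 ≤ n) (hh : h = 2 * n + 1)
    (σ : BPartition) (hσ : IsBarCore h σ)
    (hcnt : Set.ncard {x : ℕ × ℕ | Addable h 0 σ x} = 3)
    (τ : BPartition) (hτ : τ = psi h 0 σ) :
    ∃ α β γ α' β' γ' : BPartition,
      {lam | InBlock h σ 2 lam ∧ ∃ x, Removable h 0 lam x} = {α, β, γ} ∧
      domLT α β ∧ domLT β γ ∧
      {mu | InBlock h τ 2 mu ∧ ∃ x, Addable h 0 mu x} = {α', β', γ'} ∧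
      domLT α' β' ∧ domLT β' γ' ∧
      psi h 0 α = α' ∧ psi h 0 β = γ' ∧ psi h 0 γ = β' := by
  have h3 : 3 ≤ h := by omega
  obtain ⟨hm, hz⟩ := core_three hn hh hσ hcnt
  have hP := core_props hh hσ
  have hs := hσ.1
  obtain ⟨ρ, hρ⟩ : ∃ ρ, partsM σ = {h-1} + ρ :=
    ⟨(partsM σ).erase (h-1), by rw [Multiset.singleton_add, Multiset.cons_erase hm]⟩
  have hcnt1 : ∀ v ∈ partsM σ, (partsM σ).count v ≤ 1 := fun v hv => hstrict_count hs (hP.nd v hv)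
  have hc : ∀ v, ρ.count v ≤ 1 := by
    intro v
    by_cases hv : v ∈ ρ
    · have := hcnt1 v (by rw [hρ]; simp [hv])
      rw [hρ, Multiset.count_add] at this
      omega
    · rw [Multiset.count_eq_zero.2 hv]; omega
  have hr : ∀ v ∈ ρ, 0 < v ∧ ¬ Zr h v := by
    intro v hv
    have hv' : v ∈ partsM σ := by rw [hρ]; simp [hv]
    refine ⟨partsM_pos hv', fun hzv => ?_⟩
    have e := hz v hv' hzv
    subst e
    have h1 := hcnt1 _ hv'
    rw [hρ, Multiset.count_add, Multiset.count_singleton_self] at h1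
    have := Multiset.count_pos.2 hv
    omega
  obtain ⟨t1, t2⟩ := sigma_tau h3 hs (fun v hv => (hr v hv).2) hρ
  rw [← hτ] at t1 t2
  rw [hρ] at hP
  have hτc : IsBarCore h τ := core_of_props h3 t1 (by rw [t2]; exact tau_core h3 hr hP)
  obtain ⟨α, β, γ, α', β', γ', ⟨a1, a2, a3⟩, ⟨b1, b2, b3⟩, ⟨c1, c2, c3⟩, ⟨d1, d2, d3⟩,
    ⟨e1, e2, e3⟩, ⟨f1, f2, f3⟩, g1, g2, g3, g4, g5, g6, g7⟩ :=
    fam_main h3 (fun v hv => (hr v hv).2) hc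
  refine ⟨α, β, γ, α', β', γ', ?_, g1, g2, ?_, g3, g4, g5, g6, g7⟩
  · ext lam
    simp only [Set.mem_ofPred_eq, Set.mem_insert_iff, Set.mem_singleton_iff]
    constructor
    · rintro ⟨h1, x, h2⟩
      rcases sigma_class h3 hr hρ h1 h2 with h4 | h4 | h4
      · exact Or.inl (partsM_inj (h4.trans a2.symm))
      · exact Or.inr (Or.inl (partsM_inj (h4.trans b2.symm)))
      · exact Or.inr (Or.inr (partsM_inj (h4.trans c2.symm)))
    · rintro (rfl | rfl | rfl)
      · exact ⟨sigma_conv h3 hr hc hρ hσ a1 (Or.inl a2), a3⟩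
      · exact ⟨sigma_conv h3 hr hc hρ hσ b1 (Or.inr (Or.inl b2)), b3⟩
      · exact ⟨sigma_conv h3 hr hc hρ hσ c1 (Or.inr (Or.inr c2)), c3⟩
  · ext lam
    simp only [Set.mem_ofPred_eq, Set.mem_insert_iff, Set.mem_singleton_iff]
    constructor
    · rintro ⟨h1, x, h2⟩
      rcases tau_class h3 hr t2 h1 h2 with h4 | h4 | h4
      · exact Or.inl (partsM_inj (h4.trans d2.symm))
      · exact Or.inr (Or.inl (partsM_inj (h4.trans e2.symm)))
      · exact Or.inr (Or.inr (partsM_inj (h4.trans f2.symm)))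
    · rintro (rfl | rfl | rfl)
      · exact ⟨tau_conv h3 hr hc t2 hτc d1 (Or.inl d2), d3⟩
      · exact ⟨tau_conv h3 hr hc t2 hτc e1 (Or.inr (Or.inl e2)), e3⟩
      · exact ⟨tau_conv h3 hr hc t2 hτc f1 (Or.inr (Or.inr f2)), f3⟩
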